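/- Assume F is tame with Disc F ⊆ {0}, and suppose that F(M(H)) ⊆ M(G) as set germs at the origin, i.e., there exists ε > 0 with B̄_ε ⊆ U such that F(M(H) ∩ B̄_ε) ⊆ M(G). If G is tame, then the composition H = G ∘ F is tame. -/

import Mathlib

open Metric Set Function Topology

noncomputable section

/-- The singular set of a map: points where the total derivative is not surjective. -/
def Sing {E F : Type*} [NormedAddCommGroup E] [NormedSpace ℝ E] [NormedAddCommGroup F]
    [NormedSpace ℝ F] (P : E → F) : Set E :=
  {x | ¬ Function.Surjective ⇑(fderiv ℝ P x)}

/-- The Milnor set of a map (with respect to the Euclidean distance `‖x‖²`):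
points where the derivative of `x ↦ (P x, ‖x‖²)` is not surjective. -/
def MilnorSet {E F : Type*} [NormedAddCommGroup E] [NormedSpace ℝ E] [NormedAddCommGroup F]
    [NormedSpace ℝ F] (P : E → F) : Set E :=
  {x | ¬ Function.Surjective ⇑(fderiv ℝ (fun y => (P y, ‖y‖ ^ 2)) x)}

/-- Tameness: as set germs at the origin, `closure(M(P) \ Sing P) ∩ Sing P ⊆ {0}`. -/
def Tame {E F : Type*} [NormedAddCommGroup E] [NormedSpace ℝ E] [NormedAddCommGroup F]
    [NormedSpace ℝ F] (P : E → F) : Prop :=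
  ∃ ε > 0, closure ((MilnorSet P \ Sing P) ∩ ball (0 : E) ε) ∩ Sing P ∩ ball (0 : E) ε ⊆ {0}


theorem comp_list_prod {X : Type} [NormedAddCommGroup X] [NormedSpace ℝ X] (lam : X →L[ℝ] ℝ) :
    ∀ (n : ℕ) (u : Fin n → (X →L[ℝ] X)) (s : Fin n → ℝ),
      (∀ k, lam.comp (u k) = s k • lam) → lam.comp (List.ofFn u).prod = (∏ k, s k) • lam := by
  intro n
  induction n with
  | zero => intro u s _; ext; simp
  | succ n ih =>
    intro u s h
    rw [List.ofFn_succ, List.prod_cons, Fin.prod_univ_succ, ContinuousLinearMap.mul_def,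
      ← ContinuousLinearMap.comp_assoc, h 0, ContinuousLinearMap.smul_comp,
      ih (fun k => u k.succ) (fun k => s k.succ) (fun k => h k.succ), smul_smul]

def fcSeries {κ : Type} [Fintype κ] [DecidableEq κ]
    (p : FormalMultilinearSeries ℝ (κ → ℝ) ℝ) (B : Type) [NormedRing B] [NormedAlgebra ℝ B] :
    FormalMultilinearSeries ℝ (κ → B) B := fun n =>
  ∑ i : Fin n → κ, p n (fun k => Pi.single (i k) 1) •
    (ContinuousMultilinearMap.mkPiAlgebraFin ℝ n B).compContinuousLinearMap
      (fun k => ContinuousLinearMap.proj (R := ℝ) (φ := fun _ : κ => B) (i k))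

theorem fcSeries_norm {κ : Type} [Fintype κ] [DecidableEq κ]
    (p : FormalMultilinearSeries ℝ (κ → ℝ) ℝ) (B : Type) [NormedRing B] [NormedAlgebra ℝ B]
    [NormOneClass B] (n : ℕ) :
    ‖fcSeries p B n‖ ≤ ((Fintype.card κ : ℝ) + 1) ^ n * ‖p n‖ := by
  have h1 : ‖fcSeries p B n‖ ≤ ∑ i : Fin n → κ, ‖p n‖ := by
    refine ContinuousMultilinearMap.opNorm_le_bound (Finset.sum_nonneg fun _ _ => norm_nonneg _)
      (fun m => ?_)
    rw [Finset.sum_mul]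
    simp only [fcSeries, sum_apply, smul_apply,
      ContinuousMultilinearMap.compContinuousLinearMap_apply,
      ContinuousMultilinearMap.mkPiAlgebraFin_apply, ContinuousLinearMap.proj_apply]
    refine norm_sum_le_of_le _ (fun i _ => ?_)
    rw [norm_smul]
    have a1 : ‖p n (fun k => Pi.single (i k) 1)‖ ≤ ‖p n‖ := by
      refine ((p n).le_opNorm _).trans ?_
      have : ∏ k : Fin n, ‖(Pi.single (i k) 1 : κ → ℝ)‖ ≤ 1 := by
        refine Finset.prod_le_one (fun _ _ => norm_nonneg _) (fun k _ => ?_)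
        rw [Pi.norm_single]; simp
      exact mul_le_of_le_one_right (norm_nonneg _) this
    have a2 : ‖(List.ofFn fun k => m k (i k)).prod‖ ≤ ∏ k, ‖m k‖ := by
      refine (List.norm_prod_le _).trans ?_
      rw [List.map_ofFn, List.prod_ofFn]
      exact Finset.prod_le_prod (fun _ _ => norm_nonneg _) (fun k _ => norm_le_pi_norm (m k) (i k))
    gcongr
  refine h1.trans ?_
  simp only [Finset.sum_const, Finset.card_univ, Fintype.card_fun, Fintype.card_fin, nsmul_eq_mul]
  push_cast
  gcongr
  linarith

theorem funcCalc {κ : Type} [Fintype κ] [DecidableEq κ] (f : (κ → ℝ) → ℝ) (hf : AnalyticAt ℝ f 0)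
    (X : Type) [NormedAddCommGroup X] [NormedSpace ℝ X] [CompleteSpace X] [Nontrivial X] :
    ∃ fh : (κ → (X →L[ℝ] X)) → (X →L[ℝ] X), ∃ δ > 0, fh 0 = f 0 • 1 ∧
      ∀ u : κ → (X →L[ℝ] X), ‖u‖ < δ → AnalyticAt ℝ fh u ∧
        ∀ (lam : X →L[ℝ] ℝ) (s : κ → ℝ), ‖s‖ < δ → (∀ j, lam.comp (u j) = s j • lam) →
          lam.comp (fh u) = f s • lam := by
  obtain ⟨p, r, hp⟩ := hf
  let q := fcSeries p (X →L[ℝ] X)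
  have hrad : 0 < q.radius := by
    obtain ⟨ρ, hρ0, hρ⟩ := ENNReal.lt_iff_exists_nnreal_btwn.mp (hp.r_pos.trans_le hp.r_le)
    have hρ0' : 0 < ρ := by exact_mod_cast hρ0
    obtain ⟨C, hC, hb⟩ := p.norm_mul_pow_le_of_lt_radius hρ
    have hc : (0 : NNReal) < (Fintype.card κ : NNReal) + 1 := by positivity
    have : ((ρ / ((Fintype.card κ : NNReal) + 1) : NNReal) : ENNReal) ≤ q.radius := by
      refine q.le_radius_of_bound C (fun n => ?_)
      refine le_trans ?_ (hb n)
      have := fcSeries_norm p (X →L[ℝ] X) n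
      push_cast
      rw [div_pow]
      have hc' : (0 : ℝ) < ((Fintype.card κ : ℝ) + 1) ^ n := by positivity
      rw [← mul_div_assoc, div_le_iff₀ hc']
      calc _ ≤ (((Fintype.card κ : ℝ) + 1) ^ n * ‖p n‖) * (ρ : ℝ) ^ n := by gcongr
        _ = _ := by ring
    refine lt_of_lt_of_le ?_ this
    have : 0 < ρ / ((Fintype.card κ : NNReal) + 1) := by positivity
    exact_mod_cast this
  have hq := q.hasFPowerSeriesOnBall hrad
  obtain ⟨δ, hδ0, hδ⟩ := ENNReal.lt_iff_exists_nnreal_btwn.mp (lt_min hrad hp.r_pos)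
  refine ⟨q.sum, δ, by exact_mod_cast hδ0, ?_, ?_⟩
  · have := hq.coeff_zero (fun _ => 0)
    rw [← this, ← hp.coeff_zero (fun i => Pi.single i.elim0 1)]
    simp only [q, fcSeries]
    simp
    congr 2
  intro u hu
  have hu' : u ∈ Metric.eball 0 q.radius := by
    refine Metric.eball_subset_eball (hδ.le.trans (min_le_left _ _)) ?_
    rw [Metric.eball_coe]; simpa using hu
  refine ⟨hq.analyticOnNhd u hu', fun lam s hs h => ?_⟩
  have hs' : s ∈ Metric.eball 0 r := by
    refine Metric.eball_subset_eball (hδ.le.trans (min_le_right _ _)) ?_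
    rw [Metric.eball_coe]; simpa using hs
  have e1 := hq.hasSum hu'
  have e2 := hp.hasSum hs'
  rw [zero_add] at e1 e2
  have e3 := e1.mapL (ContinuousLinearMap.compL ℝ X X ℝ lam)
  have e4 := e2.smul_const lam
  refine e3.unique ?_
  convert e4 using 2 with n
  simp only [ContinuousLinearMap.compL_apply, q, fcSeries]
  ext x
  have key : ∀ i : Fin n → κ, lam.comp (List.ofFn fun k => u (i k)).prod = (∏ k, s (i k)) • lam :=
    fun i => comp_list_prod lam n (fun k => u (i k)) (fun k => s (i k)) (fun k => h (i k))
  have hsum : (fun _ : Fin n => s) = fun _ => ∑ j, s j • (Pi.single j 1 : κ → ℝ) := by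
    funext k
    exact pi_eq_sum_univ' s
  rw [hsum, ContinuousMultilinearMap.map_sum]
  simp only [sum_apply, smul_apply,
    ContinuousMultilinearMap.compContinuousLinearMap_apply,
    ContinuousMultilinearMap.mkPiAlgebraFin_apply, ContinuousLinearMap.proj_apply,
    ContinuousMultilinearMap.map_smul_univ]
  simp only [ContinuousLinearMap.comp_apply, sum_apply, map_sum,
    smul_apply, map_smul, smul_eq_mul, Finset.sum_mul]
  refine Finset.sum_congr rfl fun i _ => ?_
  have := congrArg (fun l => l x) (key i)
  simp only [ContinuousLinearMap.comp_apply, smul_apply, smul_eq_mul] at this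
  rw [this]; ring


theorem fs_char0 (K L : Type) [Field K] [Field L] [CharZero K] [Algebra K L] :
    Algebra.FormallySmooth K L := by
  obtain ⟨s, hs⟩ := exists_isTranscendenceBasis K L
  have h1 : Algebra.IsAlgebraic (IntermediateField.adjoin K (Set.range ((↑) : s → L))) L :=
    hs.isAlgebraic_field
  have : Algebra.IsSeparable (IntermediateField.adjoin K (Set.range ((↑) : s → L))) L := 
    inferInstance
  exact .of_algebraicIndependent_of_isSeparable hs.1

theorem fs_domain (A L : Type) [CommRing A] [IsDomain A] [Field L] [CharZero A] [Algebra A L]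
    [FaithfulSMul A L] : Algebra.FormallySmooth A L := by
  let K := FractionRing A
  let : Algebra K L := FractionRing.liftAlgebra A L
  have : IsScalarTower A K L := FractionRing.isScalarTower_liftAlgebra A L
  have : CharZero K := IsFractionRing.charZero A
  have : Algebra.FormallySmooth A K := .of_isLocalization (nonZeroDivisors A)
  have := fs_char0 K L
  exact .comp A K L

theorem nilp_aux {B : Type} [CommRing B] (I : Ideal B)
    (h : ∀ r ∈ I, ∀ s ∈ I, r * s = 0) : IsNilpotent I := by
  refine ⟨2, ?_⟩
  rw [pow_two]
  exact le_bot_iff.mp (Ideal.mul_le.mpr fun r hr s hs => by simpa using h r hr s hs)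

theorem deriv_ext (A L : Type) [CommRing A] [IsDomain A] [Field L] [CharZero A] [Algebra A L]
    [FaithfulSMul A L] (d : A → L) (hadd : ∀ a b, d (a + b) = d a + d b)
    (hmul : ∀ a b, d (a * b) = algebraMap A L a * d b + algebraMap A L b * d a) :
    ∃ D : Derivation ℤ L L, ∀ a, D (algebraMap A L a) = d a := by
  have hfs := fs_domain A L
  have h1 : d 1 = 0 := by
    have := hmul 1 1
    simp at this
    exact this
  have h0 : d 0 = 0 := by
    have := hadd 0 0
    simp at this
    exact this
  let φ : A →+* TrivSqZeroExt L L :=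
    { toFun := fun a => TrivSqZeroExt.inl (algebraMap A L a) + TrivSqZeroExt.inr (d a)
      map_one' := by ext <;> simp [h1]
      map_zero' := by ext <;> simp [h0]
      map_add' := fun a b => by ext <;> simp [hadd]
      map_mul' := fun a b => by ext <;> simp [hmul, mul_comm] }
  let alg : Algebra A (TrivSqZeroExt L L) := φ.toAlgebra
  let g : @AlgHom A (TrivSqZeroExt L L) L _ _ _ alg _ :=
    { TrivSqZeroExt.fstHom L L L with
      commutes' := fun a => by
        change TrivSqZeroExt.fst (φ a) = _
        simp [φ] }
  have hg : ∀ z, g z = z.fst := fun z => rfl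
  have hs : Function.Surjective g := fun z => ⟨TrivSqZeroExt.inl z, rfl⟩
  have hn : IsNilpotent (RingHom.ker (g : TrivSqZeroExt L L →+* L)) := by
    refine nilp_aux _ ?_
    intro r hr s hs
    have hr' : r.fst = 0 := hr
    have hs' : s.fst = 0 := hs
    ext <;> simp [hr', hs']
  let l := Algebra.FormallySmooth.liftOfSurjective (AlgHom.id A L) g hs hn
  have hl : ∀ x, (l x).fst = x := fun x =>
    Algebra.FormallySmooth.liftOfSurjective_apply (AlgHom.id A L) g hs hn x
  let D : Derivation ℤ L L := Derivation.mk'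
    (({ toFun := fun x => (l x).snd, map_zero' := by simp, map_add' := by simp } : L →+ L).toIntLinearMap)
    (fun a b => by simp [hl, mul_comm])
  refine ⟨D, fun a => ?_⟩
  change (l (algebraMap A L a)).snd = _
  rw [l.commutes]
  change (φ a).snd = _
  simp [φ]

structure ShiftData (X : Type) [NormedAddCommGroup X] [NormedSpace ℝ X] where
  S : X →L[ℝ] X
  T : X →L[ℝ] X
  d : X →L[ℝ] ℝ
  e : X
  S_norm : ‖S‖ ≤ 1
  T_norm : ‖T‖ ≤ 1
  S_T : S * T = 1
  d_T : d.comp T = 0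
  S_e : S e = 0
  d_e : d e = 1
  sep : ∀ v, (∀ k : ℕ, d ((S ^ k) v) = 0) → v = 0

namespace ShiftData
variable {X : Type} [NormedAddCommGroup X] [NormedSpace ℝ X] [CompleteSpace X] (A : ShiftData X)

def ev (s : ℝ) : X →L[ℝ] ℝ := A.d.comp (Ring.inverse (1 - s • A.S))

theorem unit_s {s : ℝ} (hs : |s| < 1) : IsUnit (1 - s • A.S) := by
  apply isUnit_one_sub_of_norm_lt_one
  calc ‖s • A.S‖ = |s| * ‖A.S‖ := norm_smul _ _
    _ ≤ |s| * 1 := by gcongr; exact A.S_norm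
    _ < 1 := by simpa using hs

theorem ev_rec {s : ℝ} (hs : |s| < 1) : A.ev s = A.d + s • (A.ev s).comp A.S := by
  have h := Ring.inverse_mul_cancel _ (A.unit_s hs)
  have h' : Ring.inverse (1 - s • A.S) = 1 + s • (Ring.inverse (1 - s • A.S) * A.S) := by
    rw [mul_sub, mul_one, mul_smul_comm] at h
    exact sub_eq_iff_eq_add.mp h
  unfold ev
  conv_lhs => rw [h']
  ext a
  simp

theorem ev_rec' {s : ℝ} (hs : |s| < 1) (a : X) : A.ev s a = A.d a + s * A.ev s (A.S a) := by
  have := congrArg (fun l => l a) (A.ev_rec hs)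
  simpa using this

theorem ev_T {s : ℝ} (hs : |s| < 1) : (A.ev s).comp A.T = s • A.ev s := by
  conv_lhs => rw [A.ev_rec hs]
  have : ((A.ev s).comp A.S).comp A.T = A.ev s := by
    rw [ContinuousLinearMap.comp_assoc, ← ContinuousLinearMap.mul_def, A.S_T]; rfl
  rw [ContinuousLinearMap.add_comp, A.d_T, ContinuousLinearMap.smul_comp, this, zero_add]

theorem ev_e {s : ℝ} (hs : |s| < 1) : A.ev s A.e = 1 := by
  rw [A.ev_rec' hs]; simp [A.S_e, A.d_e]

theorem ev_analytic : AnalyticAt ℝ A.ev 0 := by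
  have h1 : AnalyticAt ℝ (fun s : ℝ => Ring.inverse (1 - s • A.S)) 0 := by
    have h2 : AnalyticAt ℝ (Ring.inverse : (X →L[ℝ] X) → (X →L[ℝ] X)) (1 - (0 : ℝ) • A.S) := by
      rw [zero_smul, sub_zero]
      exact analyticAt_inverse (1 : (X →L[ℝ] X)ˣ)
    exact h2.comp (f := fun s : ℝ => 1 - s • A.S) (by fun_prop)
  exact ((ContinuousLinearMap.compL ℝ X X ℝ A.d).analyticAt _).comp h1

theorem ev_inj (v : X) (h : ∀ᶠ s in 𝓝 (0 : ℝ), A.ev s v = 0) : v = 0 := by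
  have h1 : ∀ᶠ s in 𝓝 (0 : ℝ), |s| < 1 := by
    have : Metric.ball (0 : ℝ) 1 ∈ 𝓝 (0 : ℝ) := Metric.ball_mem_nhds _ one_pos
    filter_upwards [this] with s hs
    simpa using hs
  have h0 : ∀ v : X, (∀ᶠ s in 𝓝 (0 : ℝ), A.ev s v = 0) → A.d v = 0 := by
    intro v hv
    have := hv.self_of_nhds
    rw [A.ev_rec' (by simp)] at this
    simpa using this
  apply A.sep
  have main : ∀ (k : ℕ) (v : X), (∀ᶠ s in 𝓝 (0 : ℝ), A.ev s v = 0) → A.d ((A.S ^ k) v) = 0 := by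
    intro k
    induction k with
    | zero => simpa using h0
    | succ k ih =>
      intro v hv
      have hv0 := h0 v hv
      rw [pow_succ, mul_apply_eq_comp]
      apply ih
      have hc : AnalyticAt ℝ (fun s => A.ev s (A.S v)) 0 :=
        ((ContinuousLinearMap.apply ℝ ℝ (A.S v)).analyticAt _).comp A.ev_analytic
      have hne : ∀ᶠ s in 𝓝[≠] (0 : ℝ), A.ev s (A.S v) = 0 := by
        filter_upwards [nhdsWithin_le_nhds hv, nhdsWithin_le_nhds h1, self_mem_nhdsWithin]
          with s hs hs1 hs0
        rw [A.ev_rec' hs1, hv0, zero_add, mul_eq_zero] at hs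
        exact hs.resolve_left hs0
      exact (hc.frequently_zero_iff_eventually_zero).mp hne.frequently
  exact fun k => main k v h

theorem ev_iter {s : ℝ} (hs : |s| < 1) (a : X) (b : ℕ) :
    A.ev s a = ∑ i ∈ Finset.range b, s ^ i * A.d ((A.S ^ i) a) + s ^ b * A.ev s ((A.S ^ b) a) := by
  induction b with
  | zero => simp
  | succ b ih =>
    rw [ih, Finset.sum_range_succ, A.ev_rec' hs ((A.S ^ b) a), pow_succ' A.S, mul_apply_eq_comp]
    ring

theorem ev_Tpow {s : ℝ} (hs : |s| < 1) (b : ℕ) (a : X) :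
    A.ev s ((A.T ^ b) a) = s ^ b * A.ev s a := by
  induction b generalizing a with
  | zero => simp
  | succ b ih =>
    rw [pow_succ, mul_apply_eq_comp, ih]
    have := congrArg (fun l => l a) (A.ev_T hs)
    simp only [ContinuousLinearMap.comp_apply, smul_apply, smul_eq_mul] at this
    rw [this]; ring

theorem ev_P {s : ℝ} (hs : |s| < 1) (a : X) (b : ℕ) :
    A.ev s ((1 - A.T ^ b * A.S ^ b) a) = ∑ i ∈ Finset.range b, s ^ i * A.d ((A.S ^ i) a) := by
  have := A.ev_iter hs a b
  simp only [sub_apply, one_apply_eq_self, mul_apply_eq_comp, map_sub, A.ev_Tpow hs]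
  linarith

end ShiftData

abbrev XX := BoundedContinuousFunction ℕ ℝ

def mkX (a : ℕ → ℝ) (C : ℝ) (h : ∀ k, ‖a k‖ ≤ C) : XX :=
  BoundedContinuousFunction.ofNormedAddCommGroupDiscrete a C h

def shS : XX →L[ℝ] XX :=
  LinearMap.mkContinuous
    { toFun := fun a => mkX (fun k => a (k + 1)) ‖a‖ (fun k => a.norm_coe_le_norm _)
      map_add' := fun a b => by ext k; simp [mkX]
      map_smul' := fun c a => by ext k; simp [mkX] } 1
    (fun a => by
      rw [one_mul]
      exact (BoundedContinuousFunction.norm_le (norm_nonneg _)).mpr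
        (fun k => a.norm_coe_le_norm _))

def shT : XX →L[ℝ] XX :=
  LinearMap.mkContinuous
    { toFun := fun a => mkX (fun k => Nat.casesOn k 0 (fun j => a j)) ‖a‖ (fun k => by
        cases k with
        | zero => simp
        | succ k => exact a.norm_coe_le_norm _)
      map_add' := fun a b => by ext k; cases k <;> simp [mkX]
      map_smul' := fun c a => by ext k; cases k <;> simp [mkX] } 1
    (fun a => by
      rw [one_mul]
      refine (BoundedContinuousFunction.norm_le (norm_nonneg _)).mpr (fun k => ?_)
      cases k with
      | zero => simp [mkX]
      | succ k => exact a.norm_coe_le_norm _)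

def del0 : XX →L[ℝ] ℝ :=
  LinearMap.mkContinuous
    { toFun := fun a => a 0
      map_add' := fun a b => by simp
      map_smul' := fun c a => by simp } 1
    (fun a => by rw [one_mul]; exact a.norm_coe_le_norm _)

def e0 : XX := mkX (fun k => if k = 0 then 1 else 0) 1 (fun k => by split_ifs <;> simp)

theorem shS_apply (a : XX) (k : ℕ) : shS a k = a (k + 1) := rfl
theorem del0_apply (a : XX) : del0 a = a 0 := rfl

theorem shS_pow (b : ℕ) (a : XX) (k : ℕ) : (shS ^ b) a k = a (k + b) := by
  induction b generalizing a with
  | zero => rfl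
  | succ b ih =>
    change (shS ^ b) (shS a) k = _
    rw [ih, shS_apply]; rfl

def sdX : ShiftData XX where
  S := shS
  T := shT
  d := del0
  e := e0
  S_norm := LinearMap.mkContinuous_norm_le _ zero_le_one _
  T_norm := LinearMap.mkContinuous_norm_le _ zero_le_one _
  S_T := by ext a k; rfl
  d_T := by ext a; rfl
  S_e := by ext k; simp [shS_apply, e0, mkX]
  d_e := by simp [del0_apply, e0, mkX]
  sep := fun v h => by
    ext k
    have := h k
    rw [del0_apply, shS_pow, zero_add] at this
    simpa using this


theorem an_clm_apply {E X Y : Type} [NormedAddCommGroup E] [NormedSpace ℝ E]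
    [NormedAddCommGroup X] [NormedSpace ℝ X] [NormedAddCommGroup Y] [NormedSpace ℝ Y]
    {l : E → X →L[ℝ] Y} {a : E → X} {z : E} (hl : AnalyticAt ℝ l z) (ha : AnalyticAt ℝ a z) :
    AnalyticAt ℝ (fun y => l y (a y)) z :=
  AnalyticAt.fun_comp (f := fun y => (l y, a y))
    ((ContinuousLinearMap.id ℝ (X →L[ℝ] Y)).analyticAt_bilinear (l z, a z)) (hl.prod ha)

theorem cons_norm_lt {n : ℕ} {B : Type} [NormedAddCommGroup B] {a : B} {v : Fin n → B} {δ : ℝ}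
    (hδ : 0 < δ) (h1 : ‖a‖ < δ) (h2 : ‖v‖ < δ) : ‖(Fin.cons a v : Fin (n + 1) → B)‖ < δ := by
  rw [pi_norm_lt_iff hδ]
  intro i
  refine Fin.cases ?_ (fun j => ?_) i
  · simpa using h1
  · simpa using (norm_le_pi_norm v j).trans_lt h2

theorem cons_analytic {n : ℕ} {E B : Type} [NormedAddCommGroup B] [NormedSpace ℝ B]
    [NormedAddCommGroup E] [NormedSpace ℝ E] {a : E → B} {v : E → Fin n → B} {z : E}
    (h1 : AnalyticAt ℝ a z) (h2 : AnalyticAt ℝ v z) :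
    AnalyticAt ℝ (fun y => (Fin.cons (a y) (v y) : Fin (n + 1) → B)) z := by
  rw [analyticAt_pi_iff]
  intro i
  refine Fin.cases ?_ (fun j => ?_) i
  · simpa using h1
  · simpa using (analyticAt_pi_iff.mp h2) j

theorem weier_div_aux {X : Type} [NormedAddCommGroup X] [NormedSpace ℝ X] [CompleteSpace X]
    [Nontrivial X] (A : ShiftData X) {n : ℕ}
    (f g : (Fin (n + 1) → ℝ) → ℝ) (hf : AnalyticAt ℝ f 0) (hg : AnalyticAt ℝ g 0)
    (b : ℕ) (u : ℝ → ℝ) (hu : AnalyticAt ℝ u 0) (hu0 : u 0 ≠ 0)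
    (hfu : ∀ᶠ t in 𝓝 (0 : ℝ), f (Fin.cons t 0) = t ^ b * u t) :
    ∃ (q : (Fin (n + 1) → ℝ) → ℝ) (c : ℕ → (Fin n → ℝ) → ℝ), AnalyticAt ℝ q 0 ∧
      (∀ i, AnalyticAt ℝ (c i) 0) ∧
      ∀ᶠ z in 𝓝 (0 : Fin (n + 1) → ℝ),
        g z = q z * f z + ∑ i ∈ Finset.range b, c i (Fin.tail z) * z 0 ^ i := by
  obtain ⟨fh, δf, hδf, -, Hf⟩ := funcCalc f hf X
  obtain ⟨gh, δg, hδg, -, Hg⟩ := funcCalc g hg X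
  have hU : AnalyticAt ℝ (fun z : Fin (n + 1) → ℝ => u (z 0)) 0 :=
    AnalyticAt.fun_comp (f := fun z : Fin (n + 1) → ℝ => z 0) (g := u) (by simpa using hu)
      ((ContinuousLinearMap.proj (R := ℝ) (φ := fun _ : Fin (n + 1) => ℝ) 0).analyticAt _)
  obtain ⟨uh, δu, hδu, huh0, Hu⟩ := funcCalc _ hU X
  -- the base point
  let w : ℝ → Fin (n + 1) → (X →L[ℝ] X) := fun r => Fin.cons (r • A.T) 0
  have hw0 : w 0 = 0 := by
    funext i; refine Fin.cases ?_ (fun j => ?_) i <;> simp [w]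
  have hwc : ContinuousAt w 0 :=
    (cons_analytic (by fun_prop) analyticAt_const).continuousAt
  have huc : ContinuousAt (fun r => (u 0)⁻¹ • uh (w r)) 0 := by
    have h1 : ContinuousAt uh (w 0) := by
      rw [hw0]; exact (Hu 0 (by simpa using hδu)).1.continuousAt
    have h3 : ContinuousAt (fun r => uh (w r)) 0 := ContinuousAt.comp h1 hwc
    exact h3.const_smul ((u 0)⁻¹)
  have hval : (u 0)⁻¹ • uh (w 0) = 1 := by
    rw [hw0, huh0, smul_smul]
    simp [inv_mul_cancel₀ hu0]
  have hev1 : ∀ᶠ r in 𝓝 (0 : ℝ), ‖(u 0)⁻¹ • uh (w r) - 1‖ < 1 := by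
    have h2 := (huc.sub (continuousAt_const (y := (1 : X →L[ℝ] X)))).norm
    have h3 : ‖(u 0)⁻¹ • uh (w 0) - 1‖ < 1 := by rw [hval]; simp
    exact h2.eventually_lt_const h3
  obtain ⟨η, hη, hηb⟩ := Metric.eventually_nhds_iff_ball.mp (hev1.and hfu)
  let r := min η (min δf (min δg δu)) / 2
  have hm : 0 < min η (min δf (min δg δu)) := by positivity
  have hr0 : 0 < r := half_pos hm
  have hrm : r < min η (min δf (min δg δu)) := half_lt_self hm
  have hrη : r < η := hrm.trans_le (min_le_left _ _)
  have hrf : r < δf := hrm.trans_le ((min_le_right _ _).trans (min_le_left _ _))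
  have hrg : r < δg := hrm.trans_le
    ((min_le_right _ _).trans ((min_le_right _ _).trans (min_le_left _ _)))
  have hru : r < δu := hrm.trans_le
    ((min_le_right _ _).trans ((min_le_right _ _).trans (min_le_right _ _)))
  have hnT : ‖r • A.T‖ ≤ r := by
    rw [norm_smul, Real.norm_of_nonneg hr0.le]
    exact mul_le_of_le_one_right hr0.le A.T_norm
  let W : (Fin n → ℝ) → Fin (n + 1) → (X →L[ℝ] X) := fun y => Fin.cons (r • A.T) (fun j => y j • 1)
  have hWan : AnalyticAt ℝ W 0 := by
    refine cons_analytic analyticAt_const ?_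
    rw [analyticAt_pi_iff]
    intro j
    exact ((ContinuousLinearMap.proj (R := ℝ) (φ := fun _ : Fin n => ℝ) j).analyticAt _).smul
      analyticAt_const
  have hW0 : W 0 = w r := by
    funext i; refine Fin.cases ?_ (fun j => ?_) i <;> simp [W, w]
  have hwn : ∀ {δ : ℝ}, r < δ → ‖W 0‖ < δ := by
    intro δ hδ
    rw [hW0]
    exact cons_norm_lt (hr0.trans hδ) (hnT.trans_lt hδ) (by simpa using hr0.trans hδ)
  have hAan : AnalyticAt ℝ (fun y => fh (W y)) 0 := AnalyticAt.fun_comp (Hf _ (hwn hrf)).1 hWan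
  have hGan : AnalyticAt ℝ (fun y => gh (W y)) 0 := AnalyticAt.fun_comp (Hg _ (hwn hrg)).1 hWan
  -- action on evaluation functionals
  have hWev : ∀ (s : ℝ), |s| < 1 → ∀ (y : Fin n → ℝ) (j : Fin (n + 1)),
      (A.ev s).comp (W y j) = (Fin.cons (r * s) y : Fin (n + 1) → ℝ) j • A.ev s := by
    intro s hs y j
    refine Fin.cases ?_ (fun j => ?_) j
    · simp only [W, Fin.cons_zero]
      rw [ContinuousLinearMap.comp_smul, A.ev_T hs, smul_smul]
    · simp only [W, Fin.cons_succ]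
      rw [ContinuousLinearMap.comp_smul]; rfl
  have hrs : ∀ {s : ℝ}, |s| < 1 → ‖r * s‖ < r := by
    intro s hs
    rw [Real.norm_eq_abs, abs_mul, abs_of_pos hr0]
    exact mul_lt_of_lt_one_right hr0 hs
  have h1ev : ∀ᶠ s in 𝓝 (0 : ℝ), |s| < 1 := by
    have : Metric.ball (0 : ℝ) 1 ∈ 𝓝 (0 : ℝ) := Metric.ball_mem_nhds _ one_pos
    filter_upwards [this] with s hs
    simpa using hs
  have hA0 : fh (W 0) = r ^ b • (A.T ^ b * uh (w r)) := by
    rw [← sub_eq_zero]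
    ext v
    rw [zero_apply]
    apply A.ev_inj
    filter_upwards [h1ev] with s hs
    have k1 := (Hf (W 0) (hwn hrf)).2 (A.ev s) (Fin.cons (r * s) 0)
      (cons_norm_lt hδf ((hrs hs).trans hrf) (by simpa using hδf)) (hWev s hs 0)
    have k2 := (Hu (W 0) (hwn hru)).2 (A.ev s) (Fin.cons (r * s) 0)
      (cons_norm_lt hδu ((hrs hs).trans hru) (by simpa using hδu)) (hWev s hs 0)
    have k3 := (hηb (r * s) (by simpa using (hrs hs).trans hrη)).2
    rw [hW0] at k2
    have k1' := congrArg (fun l => l v) k1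
    have k2' := congrArg (fun l => l v) k2
    simp only [ContinuousLinearMap.comp_apply, smul_apply, smul_eq_mul, Fin.cons_zero] at k1' k2'
    simp only [sub_apply, smul_apply, mul_apply_eq_comp, map_sub, map_smul, smul_eq_mul]
    rw [k1', A.ev_Tpow hs, k2', k3]
    ring
  let c0 : ℝ := (r ^ b * u 0)⁻¹
  let Ψ : (Fin n → ℝ) → (X →L[ℝ] X) := fun y =>
    c0 • (fh (W y) * A.S ^ b) + (1 - A.T ^ b * A.S ^ b)
  have hΨan : AnalyticAt ℝ Ψ 0 := by
    have h1 : AnalyticAt ℝ (fun y => fh (W y) * A.S ^ b) 0 := hAan.mul analyticAt_const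
    have h2 : AnalyticAt ℝ (fun y => c0 • (fh (W y) * A.S ^ b)) 0 :=
      (analyticAt_const (v := c0)).fun_smul h1
    exact h2.add analyticAt_const
  have hΨ0 : IsUnit (Ψ 0) := by
    have : Ψ 0 = 1 - (A.T ^ b * (1 - (u 0)⁻¹ • uh (w r)) * A.S ^ b) := by
      simp only [Ψ]
      rw [hA0, smul_mul_assoc, smul_smul]
      have : c0 * r ^ b = (u 0)⁻¹ := by
        simp only [c0]; field_simp
      rw [this, mul_sub, sub_mul, mul_one, mul_smul_comm, smul_mul_assoc]
      abel
    rw [this]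
    apply isUnit_one_sub_of_norm_lt_one
    have hlt := (hηb r (by simpa [abs_of_pos hr0] using hrη)).1
    have p1 : ∀ (B : X →L[ℝ] X), ‖B‖ ≤ 1 → ‖B ^ b‖ ≤ 1 := fun B hB =>
      (norm_pow_le _ _).trans (pow_le_one₀ (norm_nonneg _) hB)
    calc _ ≤ ‖A.T ^ b‖ * ‖1 - (u 0)⁻¹ • uh (w r)‖ * ‖A.S ^ b‖ :=
          (norm_mul_le _ _).trans (by gcongr; exact norm_mul_le _ _)
      _ ≤ 1 * ‖1 - (u 0)⁻¹ • uh (w r)‖ * 1 := by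
          gcongr
          · exact p1 _ A.T_norm
          · exact p1 _ A.S_norm
      _ < 1 := by rw [one_mul, mul_one, norm_sub_rev]; exact hlt
  have hinv : AnalyticAt ℝ (fun y => Ring.inverse (Ψ y)) 0 := by
    obtain ⟨U, hU⟩ := hΨ0
    refine AnalyticAt.fun_comp ?_ hΨan
    rw [← hU]; exact analyticAt_inverse U
  let a : (Fin n → ℝ) → X := fun y => Ring.inverse (Ψ y) (gh (W y) A.e)
  have haan : AnalyticAt ℝ a 0 :=
    an_clm_apply hinv (((ContinuousLinearMap.apply ℝ X A.e).analyticAt _).fun_comp hGan)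
  have hunit : ∀ᶠ y in 𝓝 (0 : Fin n → ℝ), IsUnit (Ψ y) :=
    hΨan.continuousAt.eventually (Units.isOpen.mem_nhds hΨ0)
  have hWn : ∀ {δ : ℝ}, r < δ → ∀ᶠ y in 𝓝 (0 : Fin n → ℝ), ‖W y‖ < δ := fun hδ =>
    hWan.continuousAt.norm.eventually_lt_const (hwn hδ)
  have hyn : ∀ {δ : ℝ}, 0 < δ → ∀ᶠ y in 𝓝 (0 : Fin n → ℝ), ‖y‖ < δ := fun {δ} hδ => by
    have : Metric.ball (0 : Fin n → ℝ) δ ∈ 𝓝 (0 : Fin n → ℝ) := Metric.ball_mem_nhds _ hδ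
    filter_upwards [this] with s hs
    simpa using hs
  have hproj0 : AnalyticAt ℝ (fun z : Fin (n + 1) → ℝ => z 0) 0 :=
    (ContinuousLinearMap.proj (R := ℝ) (φ := fun _ : Fin (n + 1) => ℝ) 0).analyticAt _
  have htail : AnalyticAt ℝ (fun z : Fin (n + 1) → ℝ => (Fin.tail z : Fin n → ℝ)) 0 := by
    rw [analyticAt_pi_iff]
    exact fun j =>
      (ContinuousLinearMap.proj (R := ℝ) (φ := fun _ : Fin (n + 1) => ℝ) j.succ).analyticAt _
  have htail0 : (Fin.tail (0 : Fin (n + 1) → ℝ) : Fin n → ℝ) = 0 := rfl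
  refine ⟨fun z => c0 * A.ev (z 0 / r) ((A.S ^ b) (a (Fin.tail z))),
    fun i y => (r ^ i)⁻¹ * A.d ((A.S ^ i) (a y)), ?_, ?_, ?_⟩
  · refine analyticAt_const.mul ?_
    have e1 : AnalyticAt ℝ (fun z : Fin (n + 1) → ℝ => A.ev (z 0 / r)) 0 := by
      refine AnalyticAt.fun_comp (f := fun z : Fin (n + 1) → ℝ => z 0 / r) ?_ ?_
      · simpa using A.ev_analytic
      · simp only [div_eq_mul_inv]; exact hproj0.mul analyticAt_const
    have e2 : AnalyticAt ℝ (fun z : Fin (n + 1) → ℝ => (A.S ^ b) (a (Fin.tail z))) 0 := by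
      refine ((A.S ^ b).analyticAt _).fun_comp ?_
      exact AnalyticAt.fun_comp (by rw [htail0]; exact haan) htail
    exact an_clm_apply e1 e2
  · intro i
    refine analyticAt_const.mul ?_
    exact (A.d.analyticAt _).fun_comp (((A.S ^ i).analyticAt _).fun_comp haan)
  · have hz0 : ∀ᶠ z in 𝓝 (0 : Fin (n + 1) → ℝ), |z 0 / r| < 1 := by
      have hc : ContinuousAt (fun z : Fin (n + 1) → ℝ => |z 0 / r|) 0 := by
        have h1 : Continuous (fun z : Fin (n + 1) → ℝ => z 0) := continuous_apply 0
        exact (h1.div_const r).abs.continuousAt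
      exact hc.eventually_lt_const (by simp)
    have hall := (hunit.and ((hWn hrf).and ((hWn hrg).and ((hyn hδf).and (hyn hδg)))))
    have hall' : ∀ᶠ z in 𝓝 (0 : Fin (n + 1) → ℝ), _ :=
      (htail.continuousAt.tendsto).eventually (by rw [htail0]; exact hall)
    filter_upwards [hz0, hall'] with z hs ⟨hU, hWf, hWg, hyf, hyg⟩
    set s := z 0 / r with hsdef
    set y : Fin n → ℝ := Fin.tail z with hy
    have hrsz : r * s = z 0 := by rw [hsdef]; field_simp
    have hcons : (Fin.cons (r * s) y : Fin (n + 1) → ℝ) = z := by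
      rw [hrsz, hy]; exact Fin.cons_self_tail z
    have k1 := (Hf (W y) hWf).2 (A.ev s) (Fin.cons (r * s) y)
      (cons_norm_lt hδf ((hrs hs).trans hrf) hyf) (hWev s hs y)
    have k2 := (Hg (W y) hWg).2 (A.ev s) (Fin.cons (r * s) y)
      (cons_norm_lt hδg ((hrs hs).trans hrg) hyg) (hWev s hs y)
    rw [hcons] at k1 k2
    have key : Ψ y (a y) = gh (W y) A.e := by
      have := congrArg (fun l => l (gh (W y) A.e)) (Ring.mul_inverse_cancel _ hU)
      simpa only [mul_apply_eq_comp, one_apply_eq_self] using this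
    have key2 := congrArg (A.ev s) key
    have k1' := congrArg (fun l => l ((A.S ^ b) (a y))) k1
    have k2' := congrArg (fun l => l A.e) k2
    simp only [ContinuousLinearMap.comp_apply, smul_apply, smul_eq_mul] at k1' k2'
    have k4 : A.ev s (Ψ y (a y)) = c0 * A.ev s (fh (W y) ((A.S ^ b) (a y))) +
        A.ev s ((1 - A.T ^ b * A.S ^ b) (a y)) := by
      change A.ev s (c0 • (fh (W y) ((A.S ^ b) (a y))) + (1 - A.T ^ b * A.S ^ b) (a y)) = _
      rw [map_add, map_smul, smul_eq_mul]
    rw [k4, k1', k2', A.ev_P hs, A.ev_e hs, mul_one] at key2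
    rw [← key2, ← hrsz]
    congr 1
    · ring
    · refine Finset.sum_congr rfl fun i _ => ?_
      rw [mul_pow]
      field_simp

theorem weier_div {n : ℕ}
    (f g : (Fin (n + 1) → ℝ) → ℝ) (hf : AnalyticAt ℝ f 0) (hg : AnalyticAt ℝ g 0)
    (b : ℕ) (u : ℝ → ℝ) (hu : AnalyticAt ℝ u 0) (hu0 : u 0 ≠ 0)
    (hfu : ∀ᶠ t in 𝓝 (0 : ℝ), f (Fin.cons t 0) = t ^ b * u t) :
    ∃ (q : (Fin (n + 1) → ℝ) → ℝ) (c : ℕ → (Fin n → ℝ) → ℝ), AnalyticAt ℝ q 0 ∧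
      (∀ i, AnalyticAt ℝ (c i) 0) ∧
      ∀ᶠ z in 𝓝 (0 : Fin (n + 1) → ℝ),
        g z = q z * f z + ∑ i ∈ Finset.range b, c i (Fin.tail z) * z 0 ^ i := by
  have : Nontrivial XX := ⟨sdX.e, 0, fun h => by
    have := sdX.d_e
    rw [h] at this; simp at this⟩
  exact weier_div_aux sdX f g hf hg b u hu hu0 hfu


theorem poly_small {P : Polynomial ℝ} {b : ℕ} (hP : P.degree < b) {w : ℝ → ℝ}
    (hw : ContinuousAt w 0) (h : ∀ᶠ t in 𝓝 (0 : ℝ), P.eval t = t ^ b * w t) : P = 0 := by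
  by_contra hne
  obtain ⟨Q, hQ, hQ0⟩ := Polynomial.exists_eq_pow_rootMultiplicity_mul_and_not_dvd P hne 0
  set k := P.rootMultiplicity 0
  have hk : k < b := by
    have h1 : (P.natDegree : WithBot ℕ) < b := by rwa [← Polynomial.degree_eq_natDegree hne]
    have h2 : P.natDegree < b := by exact_mod_cast h1
    have h3 := Polynomial.natDegree_le_of_dvd ⟨Q, hQ⟩ hne
    rw [Polynomial.natDegree_pow, Polynomial.natDegree_X_sub_C, mul_one] at h3
    exact h3.trans_lt h2
  rw [Polynomial.dvd_iff_isRoot] at hQ0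
  apply hQ0
  change Q.eval 0 = 0
  have e1 : ∀ᶠ t in 𝓝[≠] (0 : ℝ), Q.eval t = t ^ (b - k) * w t := by
    filter_upwards [h.filter_mono nhdsWithin_le_nhds, self_mem_nhdsWithin] with t ht ht0
    have ht0 : t ≠ 0 := ht0
    rw [hQ] at ht
    simp only [Polynomial.C_0, sub_zero, Polynomial.eval_mul, Polynomial.eval_pow,
      Polynomial.eval_X] at ht
    have : t ^ b = t ^ k * t ^ (b - k) := by rw [← pow_add]; congr 1; omega
    rw [this, mul_assoc] at ht
    exact mul_left_cancel₀ (pow_ne_zero _ ht0) ht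
  have t1 : Filter.Tendsto (fun t => Q.eval t) (𝓝[≠] (0 : ℝ)) (𝓝 (Q.eval 0)) :=
    (Q.continuous.tendsto 0).mono_left nhdsWithin_le_nhds
  have t2 : Filter.Tendsto (fun t => t ^ (b - k) * w t) (𝓝[≠] (0 : ℝ)) (𝓝 (0 ^ (b - k) * w 0)) :=
    (((continuous_pow (b - k)).continuousAt (x := (0 : ℝ))).mul hw).tendsto.mono_left
      nhdsWithin_le_nhds
  rw [zero_pow (by omega), zero_mul] at t2
  exact tendsto_nhds_unique (t1.congr' e1) t2

theorem weier_unit {n : ℕ} (f : (Fin (n + 1) → ℝ) → ℝ) 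
    (b : ℕ) (u : ℝ → ℝ) (hu : AnalyticAt ℝ u 0)
    (hfu : ∀ᶠ t in 𝓝 (0 : ℝ), f (Fin.cons t 0) = t ^ b * u t)
    (q : (Fin (n + 1) → ℝ) → ℝ) (c : ℕ → (Fin n → ℝ) → ℝ) (hq : AnalyticAt ℝ q 0)
    (h : ∀ᶠ z in 𝓝 (0 : Fin (n + 1) → ℝ),
        z 0 ^ b = q z * f z + ∑ i ∈ Finset.range b, c i (Fin.tail z) * z 0 ^ i) : q 0 ≠ 0 := by
  have hc0 : (Fin.cons (0 : ℝ) 0 : Fin (n + 1) → ℝ) = 0 := by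
    funext i; refine Fin.cases ?_ (fun j => ?_) i <;> simp
  have hcc : ContinuousAt (fun t : ℝ => (Fin.cons t 0 : Fin (n + 1) → ℝ)) 0 :=
    (cons_analytic analyticAt_id analyticAt_const).continuousAt
  have h1 : ∀ᶠ t in 𝓝 (0 : ℝ), t ^ b = q (Fin.cons t 0) * (t ^ b * u t) +
      ∑ i ∈ Finset.range b, c i 0 * t ^ i := by
    have h2 := hcc.tendsto
    rw [hc0] at h2
    filter_upwards [h2.eventually h, hfu] with t ht hft
    rw [hft] at ht
    simpa using ht
  let P : Polynomial ℝ := ∑ i ∈ Finset.range b, Polynomial.C (c i 0) * Polynomial.X ^ i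
  have hPe : ∀ t, P.eval t = ∑ i ∈ Finset.range b, c i 0 * t ^ i := fun t => by
    simp [P, Polynomial.eval_finsetSum]
  have hPd : P.degree < b := by
    refine Polynomial.mem_degreeLT.mp (Submodule.sum_mem _ fun i hi => ?_)
    refine Polynomial.mem_degreeLT.mpr ?_
    refine (Polynomial.degree_C_mul_X_pow_le _ _).trans_lt ?_
    exact_mod_cast Finset.mem_range.mp hi
  have hqc : ContinuousAt (fun t : ℝ => q (Fin.cons t 0)) 0 :=
    ContinuousAt.comp (g := q) (by rw [hc0]; exact hq.continuousAt) hcc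
  have hP0 : P = 0 := by
    refine poly_small hPd (w := fun t => 1 - q (Fin.cons t 0) * u t)
      (continuousAt_const.sub (hqc.mul hu.continuousAt)) ?_
    filter_upwards [h1] with t ht
    rw [hPe]; linarith
  intro hq0
  have e1 : ∀ᶠ t in 𝓝[≠] (0 : ℝ), 1 = q (Fin.cons t 0) * u t := by
    filter_upwards [h1.filter_mono nhdsWithin_le_nhds, self_mem_nhdsWithin] with t ht ht0
    have ht0 : t ≠ 0 := ht0
    rw [← hPe, hP0] at ht
    simp only [Polynomial.eval_zero, add_zero] at ht
    apply mul_left_cancel₀ (pow_ne_zero b ht0)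
    linarith
  have t2 : Filter.Tendsto (fun t : ℝ => q (Fin.cons t 0) * u t) (𝓝[≠] (0 : ℝ))
      (𝓝 (q (Fin.cons 0 0) * u 0)) :=
    (hqc.mul hu.continuousAt).tendsto.mono_left nhdsWithin_le_nhds
  rw [hc0, hq0, zero_mul] at t2
  exact one_ne_zero (tendsto_nhds_unique (tendsto_const_nhds.congr' e1) t2)

theorem exists_dir {E : Type} [NormedAddCommGroup E] [NormedSpace ℝ E] (f : E → ℝ)
    (hf : AnalyticAt ℝ f 0) (hne : ¬ ∀ᶠ z in 𝓝 (0 : E), f z = 0) :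
    ∃ v : E, ¬ ∀ᶠ t in 𝓝 (0 : ℝ), f (t • v) = 0 := by
  by_contra! hcon
  apply hne
  obtain ⟨ε, hε, hb⟩ := Metric.eventually_nhds_iff_ball.mp hf.eventually_analyticAt
  filter_upwards [Metric.ball_mem_nhds (0 : E) hε] with z hz
  have hz' : ‖z‖ < ε := by simpa using hz
  let s : Set ℝ := (fun t : ℝ => t • z) ⁻¹' ball (0 : E) ε
  have hs : Convex ℝ s := by
    have : s = (LinearMap.toSpanSingleton ℝ E z) ⁻¹' ball (0 : E) ε := rfl
    rw [this]
    exact (convex_ball _ _).linear_preimage _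
  have han : AnalyticOnNhd ℝ (fun t : ℝ => f (t • z)) s := by
    intro t ht
    exact AnalyticAt.fun_comp (f := fun t : ℝ => t • z) (hb _ ht)
      ((ContinuousLinearMap.toSpanSingleton ℝ z).analyticAt t)
  have h0 : (0 : ℝ) ∈ s := by simp [s, hε]
  have h1 : (1 : ℝ) ∈ s := by simpa [s] using hz'
  have := han.eqOn_zero_of_preconnected_of_eventuallyEq_zero hs.isPreconnected h0 (hcon z) h1
  simpa using this

theorem ratio_const {E : Type} [NormedAddCommGroup E] [NormedSpace ℝ E] (f g : E → ℝ)
    (hf : AnalyticAt ℝ f 0) (hg : AnalyticAt ℝ g 0) (hne : ¬ ∀ᶠ z in 𝓝 (0 : E), g z = 0)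
    (h : ∀ᶠ z in 𝓝 (0 : E), g z • fderiv ℝ f z = f z • fderiv ℝ g z) :
    ∃ r : ℝ, ∀ᶠ z in 𝓝 (0 : E), f z = r * g z := by
  obtain ⟨ε, hε, hb⟩ := Metric.eventually_nhds_iff_ball.mp
    ((hf.eventually_analyticAt.and hg.eventually_analyticAt).and h)
  have hex : ∃ z ∈ ball (0 : E) ε, g z ≠ 0 := by
    by_contra! hcon
    exact hne (Filter.eventually_of_mem (Metric.ball_mem_nhds _ hε) hcon)
  obtain ⟨z0, hz0, hgz0⟩ := hex
  have hnear : ∀ᶠ z in 𝓝 z0, z ∈ ball (0 : E) ε ∧ g z ≠ 0 :=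
    Filter.Eventually.and (isOpen_ball.mem_nhds hz0) ((hb z0 hz0).1.2.continuousAt.eventually_ne hgz0)
  obtain ⟨η, hη, hηb⟩ := Metric.eventually_nhds_iff_ball.mp hnear
  refine ⟨f z0 / g z0, ?_⟩
  have hconst : ∀ z ∈ ball z0 η, f z / g z = f z0 / g z0 := by
    intro z hz
    have hd : ∀ y ∈ ball z0 η, HasFDerivAt (fun z => f z * (g z)⁻¹) (0 : E →L[ℝ] ℝ) y := by
      intro y hy
      obtain ⟨⟨h1, h2⟩, h3⟩ := hb y (hηb y hy).1
      have hgy := (hηb y hy).2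
      have hi := (hasDerivAt_inv hgy).comp_hasFDerivAt y h2.differentiableAt.hasFDerivAt
      have hm := h1.differentiableAt.hasFDerivAt.mul hi
      refine hm.congr_fderiv ?_
      ext e
      have h4 := congrArg (fun l => l e) h3
      simp only [smul_apply, smul_eq_mul] at h4
      simp only [add_apply, smul_apply, smul_eq_mul, zero_apply, Function.comp_apply]
      field_simp
      linarith
    have := (convex_ball z0 η).is_const_of_fderivWithin_eq_zero (𝕜 := ℝ)
      (f := fun z => f z * (g z)⁻¹)
      (fun y hy => (hd y hy).differentiableAt.differentiableWithinAt)
      (fun y hy => by rw [fderivWithin_of_isOpen isOpen_ball hy, (hd y hy).fderiv])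
      hz (mem_ball_self hη)
    simpa [div_eq_mul_inv] using this
  have han : AnalyticOnNhd ℝ (fun z => f z - f z0 / g z0 * g z) (ball (0 : E) ε) := fun z hz =>
    (hb z hz).1.1.fun_sub (analyticAt_const.fun_mul (hb z hz).1.2)
  have hev : (fun z => f z - f z0 / g z0 * g z) =ᶠ[𝓝 z0] 0 := by
    filter_upwards [Metric.ball_mem_nhds z0 hη] with z hz
    have h1 := hconst z hz
    have h2 := (hηb z hz).2
    rw [← h1]
    simp [h2]
  have := han.eqOn_zero_of_preconnected_of_eventuallyEq_zero
    (convex_ball _ _).isPreconnected hz0 hev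
  filter_upwards [Metric.ball_mem_nhds (0 : E) hε] with z hz
  have h3 := this hz
  simp only [Pi.zero_apply] at h3
  linarith


/-- Evaluation data: a ring hom from real functions on an index type to a field, whose kernel is
the functions vanishing along a filter. -/
structure EvD (ι L : Type) [Field L] where
  U : Filter ι
  neBot : U.NeBot
  ev : (ι → ℝ) →+* L
  ev_iff : ∀ f, ev f = 0 ↔ ∀ᶠ i in U, f i = 0

namespace EvD

variable {ι L : Type} [Field L] (V : EvD ι L)

theorem ev_congr {f g : ι → ℝ} (h : ∀ᶠ i in V.U, f i = g i) : V.ev f = V.ev g := by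
  rw [← sub_eq_zero, ← map_sub, V.ev_iff]
  filter_upwards [h] with i hi
  simp [hi]

theorem ev_eq {f g : ι → ℝ} (h : V.ev f = V.ev g) : ∀ᶠ i in V.U, f i = g i := by
  rw [← sub_eq_zero, ← map_sub, V.ev_iff] at h
  filter_upwards [h] with i hi
  simpa [sub_eq_zero] using hi

/-- the partial derivative defect -/
def Dv {n : ℕ} (x : ι → Fin n → ℝ) (D : Derivation ℤ L L) (g : (Fin n → ℝ) → ℝ) : L :=
  D (V.ev fun i => g (x i)) -
    ∑ j, D (V.ev fun i => x i j) * V.ev (fun i => fderiv ℝ g (x i) (Pi.single j 1))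

/-- derivations satisfying the chain rule along `x` -/
def CSet {n : ℕ} (x : ι → Fin n → ℝ) : Set (Derivation ℤ L L) :=
  {D | ∀ f, AnalyticAt ℝ f 0 → V.Dv x D f = 0}

/-- the ring of values of analytic germs -/
def ASub {n : ℕ} (x : ι → Fin n → ℝ) : Subring L where
  carrier := {a | ∃ f, AnalyticAt ℝ f 0 ∧ V.ev (fun i => f (x i)) = a}
  mul_mem' := by
    rintro _ _ ⟨f, hf, rfl⟩ ⟨g, hg, rfl⟩
    exact ⟨fun z => f z * g z, hf.fun_mul hg, map_mul V.ev _ _⟩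
  one_mem' := ⟨fun _ => 1, analyticAt_const, map_one V.ev⟩
  add_mem' := by
    rintro _ _ ⟨f, hf, rfl⟩ ⟨g, hg, rfl⟩
    exact ⟨fun z => f z + g z, hf.fun_add hg, map_add V.ev _ _⟩
  zero_mem' := ⟨fun _ => 0, analyticAt_const, map_zero V.ev⟩
  neg_mem' := by
    rintro _ ⟨f, hf, rfl⟩
    exact ⟨fun z => - f z, hf.fun_neg, map_neg V.ev _⟩

theorem mem_ASub {n : ℕ} (x : ι → Fin n → ℝ) {f : (Fin n → ℝ) → ℝ} (hf : AnalyticAt ℝ f 0) :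
    V.ev (fun i => f (x i)) ∈ V.ASub x := ⟨f, hf, rfl⟩

/-- the field generated by values of analytic germs -/
def KSub {n : ℕ} (x : ι → Fin n → ℝ) : Subfield L := Subfield.closure (V.ASub x : Set L)

theorem mem_KSub {n : ℕ} (x : ι → Fin n → ℝ) {c : L} (hc : c ∈ V.KSub x) :
    ∃ f g, AnalyticAt ℝ f 0 ∧ AnalyticAt ℝ g 0 ∧ V.ev (fun i => g (x i)) ≠ 0 ∧
      c = V.ev (fun i => f (x i)) / V.ev (fun i => g (x i)) := by
  obtain ⟨y, hy, z, hz, rfl⟩ := Subfield.mem_closure_iff.mp hc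
  rw [Subring.closure_eq] at hy hz
  obtain ⟨f, hf, rfl⟩ := hy
  obtain ⟨g, hg, rfl⟩ := hz
  by_cases h : V.ev (fun i => g (x i)) = 0
  · refine ⟨fun _ => 0, fun _ => 1, analyticAt_const, analyticAt_const, ?_, ?_⟩
    · have : V.ev (fun i => (1 : ℝ)) = 1 := map_one V.ev
      simp [this]
    · have : V.ev (fun i => (0 : ℝ)) = 0 := map_zero V.ev
      simp [h, this]
  · exact ⟨f, g, hf, hg, h, rfl⟩

/-- constants -/
def cst : ℝ →+* L := V.ev.comp (Pi.constRingHom ι ℝ)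

theorem cst_apply (r : ℝ) : V.cst r = V.ev (fun _ => r) := rfl

section Dv
variable {n : ℕ} {x : ι → Fin n → ℝ} {D : Derivation ℤ L L}

theorem Dv_congr (hx : Filter.Tendsto x V.U (𝓝 0)) {f g : (Fin n → ℝ) → ℝ} (h : ∀ᶠ z in 𝓝 0, f z = g z) :
    V.Dv x D f = V.Dv x D g := by
  have h1 : V.ev (fun i => f (x i)) = V.ev (fun i => g (x i)) := V.ev_congr (hx.eventually h)
  have h2 : ∀ j, V.ev (fun i => fderiv ℝ f (x i) (Pi.single j 1)) =
      V.ev (fun i => fderiv ℝ g (x i) (Pi.single j 1)) := fun j => by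
    apply V.ev_congr
    filter_upwards [hx.eventually h.eventually_nhds] with i hi
    rw [Filter.EventuallyEq.fderiv_eq hi]
  simp only [Dv, h1, h2]

theorem Dv_add (hx : Filter.Tendsto x V.U (𝓝 0)) {f g : (Fin n → ℝ) → ℝ} (hf : AnalyticAt ℝ f 0) (hg : AnalyticAt ℝ g 0) :
    V.Dv x D (fun z => f z + g z) = V.Dv x D f + V.Dv x D g := by
  have h1 : V.ev (fun i => f (x i) + g (x i)) = V.ev (fun i => f (x i)) + V.ev (fun i => g (x i)) :=
    map_add V.ev _ _
  have h2 : ∀ j, V.ev (fun i => fderiv ℝ (fun z => f z + g z) (x i) (Pi.single j 1)) =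
      V.ev (fun i => fderiv ℝ f (x i) (Pi.single j 1)) +
      V.ev (fun i => fderiv ℝ g (x i) (Pi.single j 1)) := fun j => by
    rw [← map_add]
    apply V.ev_congr
    filter_upwards [hx.eventually (hf.eventually_analyticAt.and hg.eventually_analyticAt)]
      with i hi
    rw [fderiv_fun_add hi.1.differentiableAt hi.2.differentiableAt]
    rfl
  simp only [Dv, h1, h2, map_add, mul_add, Finset.sum_add_distrib]
  ring

theorem Dv_mul (hx : Filter.Tendsto x V.U (𝓝 0)) {f g : (Fin n → ℝ) → ℝ} (hf : AnalyticAt ℝ f 0) (hg : AnalyticAt ℝ g 0) :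
    V.Dv x D (fun z => f z * g z) = V.ev (fun i => f (x i)) * V.Dv x D g +
      V.ev (fun i => g (x i)) * V.Dv x D f := by
  have h1 : V.ev (fun i => f (x i) * g (x i)) = V.ev (fun i => f (x i)) * V.ev (fun i => g (x i)) :=
    map_mul V.ev _ _
  have h2 : ∀ j, V.ev (fun i => fderiv ℝ (fun z => f z * g z) (x i) (Pi.single j 1)) =
      V.ev (fun i => f (x i)) * V.ev (fun i => fderiv ℝ g (x i) (Pi.single j 1)) +
      V.ev (fun i => g (x i)) * V.ev (fun i => fderiv ℝ f (x i) (Pi.single j 1)) := fun j => by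
    rw [← map_mul, ← map_mul, ← map_add]
    apply V.ev_congr
    filter_upwards [hx.eventually (hf.eventually_analyticAt.and hg.eventually_analyticAt)]
      with i hi
    rw [fderiv_fun_mul hi.1.differentiableAt hi.2.differentiableAt]
    rfl
  simp only [Dv, h1, h2, Derivation.leibniz, smul_eq_mul, mul_add, Finset.sum_add_distrib, mul_sub,
    Finset.mul_sum]
  have e1 : ∀ (a b c : L), a * (b * c) = b * (a * c) := fun a b c => by ring
  simp only [e1 (V.ev (fun i => f (x i))), e1 (V.ev (fun i => g (x i)))]
  ring

theorem Dv_coord (j : Fin n) : V.Dv x D (fun z => z j) = 0 := by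
  have h2 : ∀ k, V.ev (fun i => fderiv ℝ (fun z : Fin n → ℝ => z j) (x i) (Pi.single k 1)) =
      if k = j then 1 else 0 := fun k => by
    have h3 : ∀ z, fderiv ℝ (fun z : Fin n → ℝ => z j) z (Pi.single k 1) =
        if k = j then 1 else 0 := fun z => by
      have : fderiv ℝ (fun z : Fin n → ℝ => z j) z =
          ContinuousLinearMap.proj (R := ℝ) (φ := fun _ : Fin n => ℝ) j :=
        (ContinuousLinearMap.proj (R := ℝ) (φ := fun _ : Fin n => ℝ) j).fderiv
      rw [this]
      simp [Pi.single_apply, eq_comm]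
    simp only [h3]
    split_ifs
    · exact map_one V.ev
    · exact map_zero V.ev
  simp [Dv, h2]

theorem Dv_pow (hx : Filter.Tendsto x V.U (𝓝 0)) {f : (Fin n → ℝ) → ℝ} (hf : AnalyticAt ℝ f 0) (h0 : V.Dv x D f = 0)
    (h1 : V.Dv x D (fun _ => 1) = 0) (k : ℕ) : V.Dv x D (fun z => f z ^ k) = 0 := by
  induction k with
  | zero => simpa using h1
  | succ k ih =>
    simp only [pow_succ]
    rw [V.Dv_mul hx (hf.fun_pow k) hf, ih, h0]; simp

theorem Dv_zero : V.Dv x D (fun _ => 0) = 0 := by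
  have : V.ev (fun _ => (0 : ℝ)) = 0 := map_zero V.ev
  simp [Dv, this]

theorem Dv_sum (hx : Filter.Tendsto x V.U (𝓝 0)) {f : ℕ → (Fin n → ℝ) → ℝ} (hf : ∀ k, AnalyticAt ℝ (f k) 0)
    (h0 : ∀ k, V.Dv x D (f k) = 0) (b : ℕ) :
    V.Dv x D (fun z => ∑ k ∈ Finset.range b, f k z) = 0 := by
  induction b with
  | zero => simpa using V.Dv_zero
  | succ b ih =>
    simp only [Finset.sum_range_succ]
    rw [V.Dv_add hx (Finset.analyticAt_fun_sum _ fun k _ => hf k) (hf b), ih, h0]; simp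

end Dv

theorem CSet_lin {n : ℕ} {y : ι → Fin n → ℝ} (B : (Fin n → ℝ) →L[ℝ] (Fin n → ℝ))
    (hy : Filter.Tendsto y V.U (𝓝 0)) {D : Derivation ℤ L L} (hD : D ∈ V.CSet y) :
    D ∈ V.CSet (fun i => B (y i)) := by
  intro f hf
  have hfB : AnalyticAt ℝ (fun z => f (B z)) 0 :=
    AnalyticAt.fun_comp (by simpa using hf) (B.analyticAt 0)
  have h1 := hD _ hfB
  have h2 : ∀ k, D (V.ev fun i => B (y i) k) =
      ∑ j, D (V.ev fun i => y i j) * V.ev (fun i => B (Pi.single j 1) k) := fun k => by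
    have hk : AnalyticAt ℝ (fun z => B z k) 0 :=
      ((ContinuousLinearMap.proj (R := ℝ) (φ := fun _ : Fin n => ℝ) k).comp B).analyticAt 0
    have h3 := hD _ hk
    rw [Dv, sub_eq_zero] at h3
    rw [h3]
    refine Finset.sum_congr rfl fun j _ => ?_
    congr 2
    funext i
    have : fderiv ℝ (fun z => B z k) (y i) =
        (ContinuousLinearMap.proj (R := ℝ) (φ := fun _ : Fin n => ℝ) k).comp B :=
      ((ContinuousLinearMap.proj (R := ℝ) (φ := fun _ : Fin n => ℝ) k).comp B).fderiv
    rw [this]; rfl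
  have h4 : ∀ j, V.ev (fun i => fderiv ℝ (fun z => f (B z)) (y i) (Pi.single j 1)) =
      ∑ k, V.ev (fun i => B (Pi.single j 1) k) * 
        V.ev (fun i => fderiv ℝ f (B (y i)) (Pi.single k 1)) := fun j => by
    simp only [← map_mul, ← map_sum]
    apply V.ev_congr
    have hBy : Filter.Tendsto (fun i => B (y i)) V.U (𝓝 0) := by
      have := (B.continuous.tendsto 0).comp hy
      rw [map_zero] at this
      exact this
    filter_upwards [hBy.eventually hf.eventually_analyticAt] with i hi
    have e1 : fderiv ℝ (fun z => f (B z)) (y i) = (fderiv ℝ f (B (y i))).comp B := by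
      have := hi.differentiableAt.hasFDerivAt.comp (y i) B.hasFDerivAt
      exact this.fderiv
    rw [e1, ContinuousLinearMap.comp_apply]
    conv_lhs => rw [pi_eq_sum_univ' (B (Pi.single j 1))]
    simp [Finset.sum_apply]
  rw [Dv, sub_eq_zero] at h1
  rw [Dv, sub_eq_zero, h1]
  simp only [h2, h4, Finset.mul_sum, Finset.sum_mul]
  rw [Finset.sum_comm]
  simp only [mul_assoc]

end EvD


namespace EvD

variable {ι L : Type} [Field L] (V : EvD ι L)

theorem an_tail {n : ℕ} : AnalyticAt ℝ (fun z : Fin (n + 1) → ℝ => (Fin.tail z : Fin n → ℝ)) 0 := by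
  rw [analyticAt_pi_iff]
  exact fun j =>
    (ContinuousLinearMap.proj (R := ℝ) (φ := fun _ : Fin (n + 1) => ℝ) j.succ).analyticAt _

theorem an_tail_comp {n : ℕ} {c : (Fin n → ℝ) → ℝ} (hc : AnalyticAt ℝ c 0) :
    AnalyticAt ℝ (fun z : Fin (n + 1) → ℝ => c (Fin.tail z)) 0 :=
  AnalyticAt.fun_comp (f := fun z : Fin (n + 1) → ℝ => (Fin.tail z : Fin n → ℝ)) hc an_tail

theorem an_coord {n : ℕ} (j : Fin n) : AnalyticAt ℝ (fun z : Fin n → ℝ => z j) 0 :=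
  (ContinuousLinearMap.proj (R := ℝ) (φ := fun _ : Fin n => ℝ) j).analyticAt _

theorem tendsto_tail {n : ℕ} {y : ι → Fin (n + 1) → ℝ} (hy : Filter.Tendsto y V.U (𝓝 0)) :
    Filter.Tendsto (fun i => (Fin.tail (y i) : Fin n → ℝ)) V.U (𝓝 0) :=
  (an_tail (n := n)).continuousAt.tendsto.comp hy

theorem Dv_tail {n : ℕ} {y : ι → Fin (n + 1) → ℝ} (hy : Filter.Tendsto y V.U (𝓝 0))
    {D : Derivation ℤ L L} (hD : D ∈ V.CSet (fun i => (Fin.tail (y i) : Fin n → ℝ)))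
    {c : (Fin n → ℝ) → ℝ} (hc : AnalyticAt ℝ c 0) :
    V.Dv y D (fun z => c (Fin.tail z)) = 0 := by
  have h1 := hD c hc
  let T : (Fin (n + 1) → ℝ) →L[ℝ] (Fin n → ℝ) :=
    ContinuousLinearMap.pi fun j =>
      ContinuousLinearMap.proj (R := ℝ) (φ := fun _ : Fin (n + 1) => ℝ) j.succ
  have hT : ∀ z, T z = Fin.tail z := fun z => rfl
  have hfd : ∀ᶠ i in V.U, fderiv ℝ (fun z : Fin (n + 1) → ℝ => c (Fin.tail z)) (y i) =
      (fderiv ℝ c (Fin.tail (y i))).comp T := by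
    filter_upwards [(V.tendsto_tail hy).eventually hc.eventually_analyticAt] with i hi
    exact (hi.differentiableAt.hasFDerivAt.comp (y i) T.hasFDerivAt).fderiv
  have h2 : V.ev (fun i => fderiv ℝ (fun z : Fin (n + 1) → ℝ => c (Fin.tail z)) (y i)
      (Pi.single 0 1)) = 0 := by
    rw [V.ev_iff]
    filter_upwards [hfd] with i hi
    rw [hi, ContinuousLinearMap.comp_apply]
    have : T (Pi.single 0 1) = 0 := by
      funext j; simp [T]
    rw [this, map_zero]
  have h3 : ∀ j : Fin n, V.ev (fun i => fderiv ℝ (fun z : Fin (n + 1) → ℝ => c (Fin.tail z)) (y i)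
      (Pi.single j.succ 1)) = V.ev (fun i => fderiv ℝ c (Fin.tail (y i)) (Pi.single j 1)) := by
    intro j
    apply V.ev_congr
    filter_upwards [hfd] with i hi
    rw [hi, ContinuousLinearMap.comp_apply]
    have : T (Pi.single j.succ 1) = Pi.single j 1 := by
      funext k; simp [T, Pi.single_apply]
    rw [this]
  rw [Dv] at h1 ⊢
  rw [Fin.sum_univ_succ, h2, mul_zero, zero_add]
  simp only [h3]
  exact h1

/-- Package of Weierstrass data. -/
theorem weier_pack {n : ℕ} {y : ι → Fin (n + 1) → ℝ} (hy : Filter.Tendsto y V.U (𝓝 0))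
    {f : (Fin (n + 1) → ℝ) → ℝ} (hf : AnalyticAt ℝ f 0)
    (hfy : V.ev (fun i => f (y i)) = 0) (b : ℕ) (u : ℝ → ℝ) (hu : AnalyticAt ℝ u 0)
    (hu0 : u 0 ≠ 0) (hfu : ∀ᶠ t in 𝓝 (0 : ℝ), f (Fin.cons t 0) = t ^ b * u t) :
    V.CSet (fun i => (Fin.tail (y i) : Fin n → ℝ)) ⊆ V.CSet y ∧
    ∀ a ∈ V.ASub y, IsIntegral (V.KSub (fun i => (Fin.tail (y i) : Fin n → ℝ))) a := by
  have hz0 : AnalyticAt ℝ (fun z : Fin (n + 1) → ℝ => z 0) 0 := an_coord 0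
  obtain ⟨q, c, hq, hc, hqc⟩ := weier_div f (fun z => z 0 ^ b) hf (hz0.fun_pow b) b u hu hu0 hfu
  have hq0 := weier_unit f b u hu hfu q c hq hqc
  have hevq : V.ev (fun i => q (y i)) ≠ 0 := by
    rw [Ne, V.ev_iff]
    intro h
    have h1 := (hq.continuousAt.tendsto.comp hy).eventually_ne hq0
    have := V.neBot
    obtain ⟨i, h2, h3⟩ := (h.and h1).exists
    exact h3 h2
  have hRan : ∀ (c : ℕ → (Fin n → ℝ) → ℝ), (∀ i, AnalyticAt ℝ (c i) 0) → ∀ k,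
      AnalyticAt ℝ (fun z : Fin (n + 1) → ℝ => c k (Fin.tail z) * z 0 ^ k) 0 := fun c hc k =>
    (an_tail_comp (hc k)).fun_mul (hz0.fun_pow k)
  have hSan : ∀ (c : ℕ → (Fin n → ℝ) → ℝ), (∀ i, AnalyticAt ℝ (c i) 0) → 
      AnalyticAt ℝ (fun z : Fin (n + 1) → ℝ =>
        ∑ k ∈ Finset.range b, c k (Fin.tail z) * z 0 ^ k) 0 := fun c hc =>
    Finset.analyticAt_fun_sum _ fun k _ => hRan c hc k
  constructor
  · intro D hD
    have h1 : V.Dv y D (fun _ => 1) = 0 := V.Dv_tail hy hD (analyticAt_const (v := (1 : ℝ)))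
    have hpow : ∀ k, V.Dv y D (fun z => z 0 ^ k) = 0 := fun k =>
      V.Dv_pow hy hz0 (V.Dv_coord 0) h1 k
    have hR : ∀ (c : ℕ → (Fin n → ℝ) → ℝ), (∀ i, AnalyticAt ℝ (c i) 0) →
        V.Dv y D (fun z => ∑ k ∈ Finset.range b, c k (Fin.tail z) * z 0 ^ k) = 0 := by
      intro c hc
      refine V.Dv_sum hy (hRan c hc) (fun k => ?_) b
      rw [V.Dv_mul hy (an_tail_comp (hc k)) (hz0.fun_pow k), hpow, V.Dv_tail hy hD (hc k)]
      simp
    have hgen : ∀ (g q : (Fin (n + 1) → ℝ) → ℝ) (c : ℕ → (Fin n → ℝ) → ℝ),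
        AnalyticAt ℝ q 0 → (∀ i, AnalyticAt ℝ (c i) 0) →
        (∀ᶠ z in 𝓝 (0 : Fin (n + 1) → ℝ),
          g z = q z * f z + ∑ i ∈ Finset.range b, c i (Fin.tail z) * z 0 ^ i) →
        V.Dv y D g = V.ev (fun i => q (y i)) * V.Dv y D f := by
      intro g q c hq hc h
      rw [V.Dv_congr hy h, V.Dv_add hy (hq.fun_mul hf) (hSan c hc), hR c hc,
        V.Dv_mul hy hq hf, hfy]
      simp
    have hDf : V.Dv y D f = 0 := by
      have h2 := hgen _ q c hq hc hqc
      rw [hpow b] at h2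
      exact (mul_eq_zero.mp h2.symm).resolve_left hevq
    intro g hg
    obtain ⟨q', c', hq', hc', hqc'⟩ := weier_div f g hf hg b u hu hu0 hfu
    rw [hgen g q' c' hq' hc' hqc', hDf, mul_zero]
  · set K := V.KSub (fun i => (Fin.tail (y i) : Fin n → ℝ)) with hK
    have hmem : ∀ {c : (Fin n → ℝ) → ℝ}, AnalyticAt ℝ c 0 →
        V.ev (fun i => c (Fin.tail (y i))) ∈ K := fun hc =>
      Subfield.subset_closure (V.mem_ASub _ hc)
    have hred : ∀ (g q : (Fin (n + 1) → ℝ) → ℝ) (c : ℕ → (Fin n → ℝ) → ℝ),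
        (∀ᶠ z in 𝓝 (0 : Fin (n + 1) → ℝ),
          g z = q z * f z + ∑ i ∈ Finset.range b, c i (Fin.tail z) * z 0 ^ i) →
        V.ev (fun i => g (y i)) = ∑ k ∈ Finset.range b,
          V.ev (fun i => c k (Fin.tail (y i))) * V.ev (fun i => y i 0) ^ k := by
      intro g q c h
      have h2 : V.ev (fun i => g (y i)) = V.ev ((fun i => q (y i)) * (fun i => f (y i)) +
          ∑ k ∈ Finset.range b, (fun i => c k (Fin.tail (y i))) * (fun i => y i 0) ^ k) := by
        apply V.ev_congr
        filter_upwards [hy.eventually h] with i hi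
        rw [hi]
        simp [Finset.sum_apply]
      rw [h2]
      simp [hfy]
    have ht : IsIntegral K (V.ev (fun i => y i 0)) := by
      have h3 := hred _ q c hqc
      have h4 : V.ev (fun i => y i 0 ^ b) = V.ev (fun i => y i 0) ^ b := map_pow V.ev _ _
      rw [h4] at h3
      let R : Polynomial K := ∑ k ∈ Finset.range b,
        Polynomial.C ⟨_, hmem (hc k)⟩ * Polynomial.X ^ k
      refine ⟨Polynomial.X ^ b - R, Polynomial.monic_X_pow_sub ?_, ?_⟩
      · refine Polynomial.mem_degreeLT.mp (Submodule.sum_mem _ fun i hi => ?_)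
        refine Polynomial.mem_degreeLT.mpr ?_
        refine (Polynomial.degree_C_mul_X_pow_le _ _).trans_lt ?_
        exact_mod_cast Finset.mem_range.mp hi
      · simp only [R, Polynomial.eval₂_sub, Polynomial.eval₂_pow, Polynomial.eval₂_X,
          Polynomial.eval₂_finsetSum, Polynomial.eval₂_mul, Polynomial.eval₂_C]
        rw [h3, sub_eq_zero]
        rfl
    rintro _ ⟨g, hg, rfl⟩
    obtain ⟨q', c', hq', hc', hqc'⟩ := weier_div f g hf hg b u hu hu0 hfu
    rw [hred g q' c' hqc']
    refine IsIntegral.sum _ fun k _ => IsIntegral.mul ?_ (ht.pow k)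
    exact isIntegral_algebraMap (R := K) (x := ⟨_, hmem (hc' k)⟩)

end EvD


theorem int_trans_sub {L : Type} [Field L] (S : Set L) (K' : Subfield L)
    (h : ∀ a ∈ S, IsIntegral K' a) {ρ : L} (hρ : IsIntegral (Subfield.closure S) ρ) :
    IsIntegral K' ρ := by
  have h1 : Subfield.closure S ≤ (algebraicClosure K' L).toSubfield := by
    rw [Subfield.closure_le]
    intro a ha
    exact mem_algebraicClosure_iff.mpr (h a ha).isAlgebraic
  have h2 : ∀ a ∈ Subfield.closure S, IsIntegral K' a := fun a ha =>
    (mem_algebraicClosure_iff.mp (h1 ha)).isIntegral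
  let φ : Subfield.closure S →+* integralClosure K' L :=
    { toFun := fun a => ⟨a.1, h2 a.1 a.2⟩
      map_one' := rfl
      map_mul' := fun _ _ => rfl
      map_zero' := rfl
      map_add' := fun _ _ => rfl }
  obtain ⟨P, hP, hP0⟩ := hρ
  refine isIntegral_trans (R := K') (A := integralClosure K' L) ρ ⟨P.map φ, hP.map φ, ?_⟩
  rw [Polynomial.eval₂_map]
  exact hP0

namespace EvD

variable {ι L : Type} [Field L] (V : EvD ι L)

/-- the partial derivatives extended to `L` when there are no relations -/
theorem exists_partial {n : ℕ} {x : ι → Fin n → ℝ} (hx : Filter.Tendsto x V.U (𝓝 0))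
    (hp : ∀ f, AnalyticAt ℝ f 0 → V.ev (fun i => f (x i)) = 0 → ∀ᶠ z in 𝓝 0, f z = 0)
    (j : Fin n) : ∃ D : Derivation ℤ L L, ∀ f, AnalyticAt ℝ f 0 →
      D (V.ev fun i => f (x i)) = V.ev (fun i => fderiv ℝ f (x i) (Pi.single j 1)) := by
  have hL : CharZero L := charZero_of_injective_ringHom V.cst.injective
  have hwd : ∀ f g, AnalyticAt ℝ f 0 → AnalyticAt ℝ g 0 →
      V.ev (fun i => f (x i)) = V.ev (fun i => g (x i)) →
      V.ev (fun i => fderiv ℝ f (x i) (Pi.single j 1)) =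
        V.ev (fun i => fderiv ℝ g (x i) (Pi.single j 1)) := by
    intro f g hf hg h
    have h1 := hp (fun z => f z - g z) (hf.fun_sub hg) (by
      have : V.ev (fun i => f (x i) - g (x i)) = V.ev (fun i => f (x i)) - V.ev (fun i => g (x i)) :=
        map_sub V.ev _ _
      rw [this, h, sub_self])
    have h2 : ∀ᶠ z in 𝓝 0, f z = g z := by
      filter_upwards [h1] with z hz
      linarith
    apply V.ev_congr
    filter_upwards [hx.eventually h2.eventually_nhds] with i hi
    rw [Filter.EventuallyEq.fderiv_eq hi]
  let d : V.ASub x → L := fun a =>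
    V.ev (fun i => fderiv ℝ (Classical.choose a.2) (x i) (Pi.single j 1))
  have hd : ∀ f (hf : AnalyticAt ℝ f 0) (a : V.ASub x), a.1 = V.ev (fun i => f (x i)) →
      d a = V.ev (fun i => fderiv ℝ f (x i) (Pi.single j 1)) := by
    intro f hf a ha
    have hs := Classical.choose_spec a.2
    exact hwd _ _ hs.1 hf (hs.2.trans ha)
  obtain ⟨D, hD⟩ := deriv_ext (V.ASub x) L d (by
    rintro ⟨_, f, hf, rfl⟩ ⟨_, g, hg, rfl⟩
    rw [hd f hf ⟨_, f, hf, rfl⟩ rfl, hd g hg ⟨_, g, hg, rfl⟩ rfl,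
      hd _ (hf.fun_add hg) _ (map_add V.ev _ _).symm, ← map_add]
    apply V.ev_congr
    filter_upwards [hx.eventually (hf.eventually_analyticAt.and hg.eventually_analyticAt)]
      with i hi
    rw [fderiv_fun_add hi.1.differentiableAt hi.2.differentiableAt]
    rfl) (by
    rintro ⟨_, f, hf, rfl⟩ ⟨_, g, hg, rfl⟩
    rw [hd f hf ⟨_, f, hf, rfl⟩ rfl, hd g hg ⟨_, g, hg, rfl⟩ rfl,
      hd _ (hf.fun_mul hg) _ (map_mul V.ev _ _).symm]
    change _ = V.ev _ * V.ev _ + V.ev _ * V.ev _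
    rw [← map_mul, ← map_mul, ← map_add]
    apply V.ev_congr
    filter_upwards [hx.eventually (hf.eventually_analyticAt.and hg.eventually_analyticAt)]
      with i hi
    rw [fderiv_fun_mul hi.1.differentiableAt hi.2.differentiableAt]
    rfl)
  refine ⟨D, fun f hf => ?_⟩
  have := hD ⟨_, V.mem_ASub x hf⟩
  rw [hd f hf _ rfl] at this
  exact this

theorem claim_free {n : ℕ} {x : ι → Fin n → ℝ} (hx : Filter.Tendsto x V.U (𝓝 0))
    (hp : ∀ f, AnalyticAt ℝ f 0 → V.ev (fun i => f (x i)) = 0 → ∀ᶠ z in 𝓝 0, f z = 0)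
    {ρ : L} (hρ : IsIntegral (V.KSub x) ρ) (hD : ∀ D ∈ V.CSet x, D ρ = 0) :
    ∃ P : Polynomial ℝ, P ≠ 0 ∧ P.eval₂ V.cst ρ = 0 := by
  choose D hDs using V.exists_partial hx hp
  have hDC : ∀ j, D j ∈ V.CSet x := by
    intro j f hf
    have h2 : ∀ k, D j (V.ev fun i => x i k) = if k = j then 1 else 0 := fun k => by
      rw [hDs j _ (an_coord k)]
      have h3 : ∀ z, fderiv ℝ (fun z : Fin n → ℝ => z k) z (Pi.single j 1) =
          if k = j then 1 else 0 := fun z => by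
        have : fderiv ℝ (fun z : Fin n → ℝ => z k) z =
            ContinuousLinearMap.proj (R := ℝ) (φ := fun _ : Fin n => ℝ) k :=
          (ContinuousLinearMap.proj (R := ℝ) (φ := fun _ : Fin n => ℝ) k).fderiv
        rw [this]
        simp [Pi.single_apply]
      simp only [h3]
      split_ifs
      · exact map_one V.ev
      · exact map_zero V.ev
    simp [Dv, h2, hDs j f hf]
  have hDK : ∀ j, ∀ c ∈ V.KSub x, D j c ∈ V.KSub x := by
    intro j c hc
    obtain ⟨f, g, hf, hg, hg0, rfl⟩ := V.mem_KSub x hc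
    have hmem : ∀ {f}, AnalyticAt ℝ f 0 → V.ev (fun i => f (x i)) ∈ V.KSub x := fun hf =>
      Subfield.subset_closure (V.mem_ASub _ hf)
    have hmem' : ∀ {f}, AnalyticAt ℝ f 0 → D j (V.ev (fun i => f (x i))) ∈ V.KSub x := by
      intro f hf
      rw [hDs j f hf]
      exact hmem (f := fun z => fderiv ℝ f z (Pi.single j 1))
        (an_clm_apply hf.fderiv analyticAt_const)
    rw [Derivation.leibniz_div]
    simp only [smul_eq_mul]
    refine mul_mem (pow_mem (inv_mem (hmem hg)) 2) (sub_mem ?_ ?_)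
    · exact mul_mem (hmem hg) (hmem' hf)
    · exact mul_mem (hmem hf) (hmem' hg)
  let P := minpoly (V.KSub x) ρ
  have hPρ : Polynomial.aeval ρ P = 0 := minpoly.aeval _ _
  have hPm : P.Monic := minpoly.monic hρ
  have hcoef : ∀ j k, D j (P.coeff k : L) = 0 := by
    intro j
    let Q : Polynomial (V.KSub x) := ∑ k ∈ Finset.range P.natDegree,
      Polynomial.C ⟨D j (P.coeff k : L), hDK j _ (P.coeff k).2⟩ * Polynomial.X ^ k
    have hpowD : ∀ k : ℕ, D j (ρ ^ k) = 0 := fun k => by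
      rw [Derivation.leibniz_pow, hD _ (hDC j)]; simp
    have hQ0 : Polynomial.aeval ρ Q = 0 := by
      have h1 := congrArg (D j) hPρ
      rw [Polynomial.aeval_eq_sum_range, map_zero, map_sum, Finset.sum_range_succ] at h1
      have h4 : P.coeff P.natDegree = 1 := hPm
      rw [h4, one_smul, hpowD, add_zero] at h1
      rw [← h1, map_sum]
      refine Finset.sum_congr rfl fun k _ => ?_
      have h5 : P.coeff k • ρ ^ k = (P.coeff k : L) * ρ ^ k := rfl
      rw [h5, Derivation.leibniz, hpowD, smul_zero, zero_add, smul_eq_mul,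
        map_mul, map_pow, Polynomial.aeval_X, Polynomial.aeval_C, mul_comm]
      rfl
    have hQd : Q.degree < P.natDegree := by
      refine Polynomial.mem_degreeLT.mp (Submodule.sum_mem _ fun i hi => ?_)
      refine Polynomial.mem_degreeLT.mpr ?_
      refine (Polynomial.degree_C_mul_X_pow_le _ _).trans_lt ?_
      exact_mod_cast Finset.mem_range.mp hi
    have hQz : Q = 0 := by
      by_contra hne
      have := minpoly.degree_le_of_ne_zero _ ρ hne hQ0
      rw [← Polynomial.degree_eq_natDegree hPm.ne_zero] at hQd
      exact absurd hQd (not_lt.mpr this)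
    intro k
    rcases lt_trichotomy k P.natDegree with hk | hk | hk
    · have h6 : Q.coeff k = ⟨D j (P.coeff k : L), hDK j _ (P.coeff k).2⟩ := by
        simp only [Q, Polynomial.finsetSum_coeff, Polynomial.coeff_C_mul_X_pow]
        rw [Finset.sum_eq_single k]
        · simp
        · intro b _ hb; simp [hb.symm]
        · intro h; exact absurd (Finset.mem_range.mpr hk) h
      rw [hQz, Polynomial.coeff_zero] at h6
      exact (congrArg Subtype.val h6).symm
    · have h4 : P.coeff P.natDegree = 1 := hPm
      rw [hk, h4]
      simp
    · rw [Polynomial.coeff_eq_zero_of_natDegree_lt hk]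
      simp
  have hreal : ∀ k, ∃ r : ℝ, V.cst r = (P.coeff k : L) := by
    intro k
    obtain ⟨f, g, hf, hg, hg0, hfg⟩ := V.mem_KSub x (P.coeff k).2
    have hgne : ¬ ∀ᶠ z in 𝓝 (0 : Fin n → ℝ), g z = 0 := fun h =>
      hg0 ((V.ev_iff _).mpr (hx.eventually h))
    have hrel : ∀ j, ∀ᶠ z in 𝓝 (0 : Fin n → ℝ), g z * fderiv ℝ f z (Pi.single j 1) -
        f z * fderiv ℝ g z (Pi.single j 1) = 0 := by
      intro j
      refine hp _ ((hg.fun_mul (an_clm_apply hf.fderiv analyticAt_const)).fun_sub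
        (hf.fun_mul (an_clm_apply hg.fderiv analyticAt_const))) ?_
      have h1 : V.ev (fun i => f (x i)) = (P.coeff k : L) * V.ev (fun i => g (x i)) := by
        rw [hfg]; field_simp
      have h2 := congrArg (D j) h1
      rw [Derivation.leibniz, hcoef, smul_zero, add_zero, smul_eq_mul, hDs j f hf, hDs j g hg] at h2
      have h3 : V.ev (fun i => g (x i) * fderiv ℝ f (x i) (Pi.single j 1) -
        f (x i) * fderiv ℝ g (x i) (Pi.single j 1)) =
        V.ev (fun i => g (x i)) * V.ev (fun i => fderiv ℝ f (x i) (Pi.single j 1)) -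
        V.ev (fun i => f (x i)) * V.ev (fun i => fderiv ℝ g (x i) (Pi.single j 1)) := by
        rw [← map_mul, ← map_mul, ← map_sub]; rfl
      rw [h3, h2, h1]; ring
    obtain ⟨r, hr⟩ := ratio_const f g hf hg hgne (by
      filter_upwards [Filter.eventually_all.mpr hrel] with z hz
      refine ContinuousLinearMap.ext fun v => ?_
      rw [pi_eq_sum_univ' v]
      simp only [map_sum, smul_apply, smul_eq_mul, map_smul]
      refine Finset.sum_congr rfl fun j _ => ?_
      have := hz j
      linear_combination (v j) * this)
    refine ⟨r, ?_⟩
    rw [hfg, eq_div_iff hg0, cst_apply, ← map_mul]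
    apply V.ev_congr
    filter_upwards [hx.eventually hr] with i hi
    simp [hi]
  choose r hr using hreal
  let R : Polynomial ℝ := ∑ k ∈ Finset.range (P.natDegree + 1), Polynomial.C (r k) * Polynomial.X ^ k
  refine ⟨R, ?_, ?_⟩
  · intro h0
    have h1 : R.coeff P.natDegree = r P.natDegree := by
      simp only [R, Polynomial.finsetSum_coeff, Polynomial.coeff_C_mul_X_pow]
      rw [Finset.sum_eq_single P.natDegree]
      · simp
      · intro b _ hb; simp [hb.symm]
      · intro h; simp at h
    have h2 := hr P.natDegree
    have h4 : P.coeff P.natDegree = 1 := hPm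
    rw [← h1, h0, h4] at h2
    simp at h2
  · simp only [R, Polynomial.eval₂_finsetSum, Polynomial.eval₂_mul, Polynomial.eval₂_C,
      Polynomial.eval₂_pow, Polynomial.eval₂_X, hr]
    rw [Polynomial.aeval_eq_sum_range] at hPρ
    exact hPρ

end EvD


namespace EvD

variable {ι L : Type} [Field L] (V : EvD ι L)

theorem claim : ∀ (n : ℕ) (x : ι → Fin n → ℝ), Filter.Tendsto x V.U (𝓝 0) →
    ∀ ρ : L, IsIntegral (V.KSub x) ρ → (∀ D ∈ V.CSet x, D ρ = 0) →
    ∃ P : Polynomial ℝ, P ≠ 0 ∧ P.eval₂ V.cst ρ = 0 := by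
  intro n
  induction n with
  | zero =>
    intro x hx ρ hρ hD
    refine V.claim_free hx ?_ hρ hD
    intro f hf hfx
    rw [V.ev_iff] at hfx
    have := V.neBot
    obtain ⟨i, hi⟩ := hfx.exists
    refine Filter.Eventually.of_forall fun z => ?_
    rwa [Subsingleton.elim z (x i)]
  | succ m ih =>
    intro x hx ρ hρ hD
    by_cases hp : ∀ f, AnalyticAt ℝ f 0 → V.ev (fun i => f (x i)) = 0 → ∀ᶠ z in 𝓝 0, f z = 0
    · exact V.claim_free hx hp hρ hD
    push Not at hp
    obtain ⟨f, hf, hfx, hne⟩ := hp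
    have hne' : ¬ ∀ᶠ z in 𝓝 0, f z = 0 := by simpa using hne
    have hf0 : f 0 = 0 := by
      by_contra h0
      have h1 := (hf.continuousAt.tendsto.comp hx).eventually_ne h0
      have := V.neBot
      obtain ⟨i, h2, h3⟩ := (((V.ev_iff _).mp hfx).and h1).exists
      exact h3 h2
    obtain ⟨v, hv⟩ := exists_dir f hf hne'
    have hv0 : v ≠ 0 := by
      rintro rfl
      apply hv
      simp [hf0]
    have he0 : (Pi.single 0 1 : Fin (m + 1) → ℝ) ≠ 0 := by simp
    obtain ⟨B, hB⟩ := SeparatingDual.exists_continuousLinearEquiv_apply_eq (R := ℝ) he0 hv0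
    let y : ι → Fin (m + 1) → ℝ := fun i => B.symm (x i)
    have hBy : (fun i => (B : (Fin (m + 1) → ℝ) →L[ℝ] (Fin (m + 1) → ℝ)) (y i)) = x := by
      funext i; simp [y]
    have hy : Filter.Tendsto y V.U (𝓝 0) := by
      have := (B.symm.continuous.tendsto 0).comp hx
      rw [map_zero] at this
      exact this
    have hBan : ∀ {g : (Fin (m + 1) → ℝ) → ℝ}, AnalyticAt ℝ g 0 →
        AnalyticAt ℝ (fun z => g (B z)) 0 := fun hg =>
      AnalyticAt.fun_comp (by simpa using hg)
        ((B : (Fin (m + 1) → ℝ) →L[ℝ] (Fin (m + 1) → ℝ)).analyticAt 0)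
    have hBev : ∀ (g : (Fin (m + 1) → ℝ) → ℝ),
        V.ev (fun i => g (B (y i))) = V.ev (fun i => g (x i)) := fun g => by
      simp [y]
    have hh : AnalyticAt ℝ (fun t : ℝ => f (t • v)) 0 :=
      AnalyticAt.fun_comp (f := fun t : ℝ => t • v) (by simpa using hf)
        ((ContinuousLinearMap.toSpanSingleton ℝ v).analyticAt 0)
    obtain ⟨b, u, hu, hu0, hfu⟩ := hh.exists_eventuallyEq_pow_smul_nonzero_iff.mpr hv
    have hcons : ∀ t : ℝ, B (Fin.cons t 0) = t • v := fun t => by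
      rw [← hB, ← map_smul]
      congr 1
      funext i
      refine Fin.cases ?_ (fun j => ?_) i <;> simp
    obtain ⟨hC, hA⟩ := V.weier_pack hy (hBan hf) (by rw [hBev, hfx]) b u hu hu0 (by
      filter_upwards [hfu] with t ht
      rw [hcons, ht]; simp)
    refine ih _ (V.tendsto_tail hy) ρ ?_ ?_
    · refine int_trans_sub (V.ASub x : Set L) _ ?_ hρ
      rintro _ ⟨g, hg, rfl⟩
      rw [← hBev]
      exact hA _ (V.mem_ASub y (hBan hg))
    · intro D hD'
      apply hD
      have := V.CSet_lin (B : (Fin (m + 1) → ℝ) →L[ℝ] (Fin (m + 1) → ℝ)) hy (hC hD')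
      rwa [hBy] at this

/-- an infinitesimal which is algebraic over the reals vanishes -/
theorem infinitesimal_zero {r : ι → ℝ} (hr : Filter.Tendsto r V.U (𝓝 0)) {P : Polynomial ℝ}
    (hP : P ≠ 0) (h : P.eval₂ V.cst (V.ev r) = 0) : V.ev r = 0 := by
  obtain ⟨Q, hQ, hQ0⟩ := Polynomial.exists_eq_pow_rootMultiplicity_mul_and_not_dvd P hP 0
  rw [Polynomial.dvd_iff_isRoot] at hQ0
  have hQev : ∀ Q : Polynomial ℝ, Q.eval₂ V.cst (V.ev r) = V.ev (fun i => Q.eval (r i)) := by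
    intro Q
    induction Q using Polynomial.induction_on' with
    | add p q hp hq =>
      rw [Polynomial.eval₂_add, hp, hq, ← map_add]
      simp only [Polynomial.eval_add]
      rfl
    | monomial k a =>
      rw [Polynomial.eval₂_monomial, cst_apply, ← map_pow, ← map_mul]
      simp only [Polynomial.eval_monomial]
      rfl
  have hQne : Q.eval₂ V.cst (V.ev r) ≠ 0 := by
    rw [hQev, Ne, V.ev_iff]
    intro h1
    have h2 := ((Q.continuous.tendsto 0).comp hr).eventually_ne hQ0
    have := V.neBot
    obtain ⟨i, h2, h3⟩ := (h1.and h2).exists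
    exact h3 h2
  rw [hQ, Polynomial.eval₂_mul] at h
  have h3 := (mul_eq_zero.mp h).resolve_right hQne
  simp only [Polynomial.C_0, sub_zero, Polynomial.eval₂_pow, Polynomial.eval₂_X] at h3
  exact eq_zero_of_pow_eq_zero h3

theorem main_abs {m k : ℕ} (x : ι → Fin m → ℝ) (hx : Filter.Tendsto x V.U (𝓝 0))
    (F : Fin k → (Fin m → ℝ) → ℝ) (hF : ∀ i, AnalyticAt ℝ (F i) 0)
    (hFx : ∀ᶠ i in V.U, ∀ l, F l (x i) = 0) (w : ι → Fin k → ℝ)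
    (hw : ∀ᶠ i in V.U, ∀ j, x i j = ∑ l, w i l * fderiv ℝ (F l) (x i) (Pi.single j 1)) :
    ∀ᶠ i in V.U, x i = 0 := by
  let ρ : (Fin m → ℝ) → ℝ := fun z => ∑ j, z j * z j
  have hρan : AnalyticAt ℝ ρ 0 :=
    Finset.analyticAt_fun_sum _ fun j _ => (an_coord j).fun_mul (an_coord j)
  have hρ0 : ρ 0 = 0 := by simp [ρ]
  have hρt : Filter.Tendsto (fun i => ρ (x i)) V.U (𝓝 0) := by
    have := hρan.continuousAt.tendsto.comp hx
    rw [hρ0] at this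
    exact this
  have hρev : V.ev (fun i => ρ (x i)) = ∑ j, V.ev (fun i => x i j) * V.ev (fun i => x i j) := by
    simp only [← map_mul, ← map_sum]
    apply V.ev_congr
    filter_upwards with i
    simp [ρ, Finset.sum_apply]
  have hxw : ∀ j, V.ev (fun i => x i j) = ∑ l, V.ev (fun i => w i l) *
      V.ev (fun i => fderiv ℝ (F l) (x i) (Pi.single j 1)) := fun j => by
    simp only [← map_mul, ← map_sum]
    apply V.ev_congr
    filter_upwards [hw] with i hi
    rw [hi j]
    simp [Finset.sum_apply]
  have hD : ∀ D ∈ V.CSet x, D (V.ev (fun i => ρ (x i))) = 0 := by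
    intro D hD
    have h1 : ∀ l, ∑ j, D (V.ev fun i => x i j) *
        V.ev (fun i => fderiv ℝ (F l) (x i) (Pi.single j 1)) = 0 := fun l => by
      have h2 := hD (F l) (hF l)
      rw [Dv, sub_eq_zero] at h2
      rw [← h2]
      have h3 : V.ev (fun i => F l (x i)) = 0 := by
        rw [V.ev_iff]
        filter_upwards [hFx] with i hi using hi l
      rw [h3, map_zero]
    have h4 : ∑ j, V.ev (fun i => x i j) * D (V.ev fun i => x i j) = 0 := by
      have h5 : ∀ j, V.ev (fun i => x i j) * D (V.ev fun i => x i j) =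
          ∑ l, V.ev (fun i => w i l) * (D (V.ev fun i => x i j) *
            V.ev (fun i => fderiv ℝ (F l) (x i) (Pi.single j 1))) := fun j => by
        generalize D (V.ev fun i => x i j) = d
        rw [hxw j, Finset.sum_mul]
        exact Finset.sum_congr rfl fun l _ => by ring
      simp only [h5]
      rw [Finset.sum_comm]
      simp only [← Finset.mul_sum, h1, mul_zero, Finset.sum_const_zero]
    rw [hρev, map_sum]
    simp only [Derivation.leibniz, smul_eq_mul, Finset.sum_add_distrib, h4, add_zero]
  obtain ⟨P, hP, hP0⟩ := V.claim m x hx _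
    (isIntegral_algebraMap (R := V.KSub x)
      (x := ⟨_, Subfield.subset_closure (V.mem_ASub x hρan)⟩)) hD
  have hfin := V.infinitesimal_zero hρt hP hP0
  rw [V.ev_iff] at hfin
  filter_upwards [hfin] with i hi
  have h6 := (Finset.sum_eq_zero_iff_of_nonneg (fun j _ => mul_self_nonneg (x i j))).mp hi
  funext j
  exact mul_self_eq_zero.mp (h6 j (Finset.mem_univ j))

end EvD


/-- The evaluation data attached to an ultrafilter. -/
def evU {ι : Type} (u : Ultrafilter ι) : EvD ι ((u : Filter ι).Germ ℝ) where
  U := u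
  neBot := inferInstance
  ev := Filter.Germ.coeRingHom (u : Filter ι)
  ev_iff := fun f => by
    change ((f : (u : Filter ι).Germ ℝ) = ((0 : ι → ℝ) : (u : Filter ι).Germ ℝ)) ↔ _
    rw [Filter.Germ.coe_eq]
    rfl

theorem main_lemma {M N : ℕ} (F : EuclideanSpace ℝ (Fin M) → EuclideanSpace ℝ (Fin N))
    (hF : AnalyticAt ℝ F 0) :
    ∀ᶠ x in 𝓝 (0 : EuclideanSpace ℝ (Fin M)), F x = 0 →
      (∃ l : EuclideanSpace ℝ (Fin N) →ₗ[ℝ] ℝ, ∀ h, inner ℝ x h = l (fderiv ℝ F x h)) → x = 0 := by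
  classical
  by_contra hcon
  rw [Filter.not_eventually] at hcon
  have hne : (𝓝 (0 : EuclideanSpace ℝ (Fin M)) ⊓ Filter.principal {x | ¬ (F x = 0 →
      (∃ l : EuclideanSpace ℝ (Fin N) →ₗ[ℝ] ℝ, ∀ h, inner ℝ x h = l (fderiv ℝ F x h)) →
        x = 0)}).NeBot := Filter.frequently_mem_iff_neBot.mp hcon
  obtain ⟨u, hu⟩ := Ultrafilter.exists_le (𝓝 (0 : EuclideanSpace ℝ (Fin M)) ⊓
    Filter.principal {x | ¬ (F x = 0 → (∃ l : EuclideanSpace ℝ (Fin N) →ₗ[ℝ] ℝ,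
      ∀ h, inner ℝ x h = l (fderiv ℝ F x h)) → x = 0)})
  have hu0 : (u : Filter (EuclideanSpace ℝ (Fin M))) ≤ 𝓝 0 := hu.trans inf_le_left
  have hub : ∀ᶠ x in (u : Filter (EuclideanSpace ℝ (Fin M))), F x = 0 ∧
      (∃ l : EuclideanSpace ℝ (Fin N) →ₗ[ℝ] ℝ, ∀ h, inner ℝ x h = l (fderiv ℝ F x h)) ∧ x ≠ 0 := by
    have := hu.trans inf_le_right
    rw [Filter.le_principal_iff] at this
    filter_upwards [this] with x hx
    have hx : ¬ _ := hx
    push Not at hx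
    exact ⟨hx.1, hx.2.1, hx.2.2⟩
  let e := EuclideanSpace.equiv (Fin M) ℝ
  let e' := EuclideanSpace.equiv (Fin N) ℝ
  let pr : Fin N → EuclideanSpace ℝ (Fin N) →L[ℝ] ℝ := fun l =>
    (ContinuousLinearMap.proj (R := ℝ) (φ := fun _ : Fin N => ℝ) l).comp
      (e' : EuclideanSpace ℝ (Fin N) →L[ℝ] (Fin N → ℝ))
  have hpr : ∀ l v, pr l v = v l := fun l v => rfl
  let es : (Fin M → ℝ) →L[ℝ] EuclideanSpace ℝ (Fin M) := e.symm
  have hes : ∀ x, es (e x) = x := fun x => e.symm_apply_apply x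
  let w : EuclideanSpace ℝ (Fin M) → Fin N → ℝ := fun x l =>
    if h : ∃ l : EuclideanSpace ℝ (Fin N) →ₗ[ℝ] ℝ, ∀ h, inner ℝ x h = l (fderiv ℝ F x h)
    then Classical.choose h (EuclideanSpace.single l 1) else 0
  have het : Filter.Tendsto (fun x => e x) (u : Filter (EuclideanSpace ℝ (Fin M))) (𝓝 0) := by
    have := (e.continuous.tendsto 0).mono_left hu0
    rwa [map_zero] at this
  have hmain := (evU u).main_abs (fun x => e x) het (fun l z => pr l (F (es z))) ?_ ?_ w ?_
  · obtain ⟨x, hx1, hx2⟩ := (hub.and hmain).exists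
    exact hx1.2.2 (by simpa using hx2)
  · intro l
    refine ((pr l).analyticAt _).fun_comp ?_
    refine AnalyticAt.fun_comp ?_ (es.analyticAt 0)
    rwa [map_zero]
  · change ∀ᶠ x in (u : Filter (EuclideanSpace ℝ (Fin M))), _
    filter_upwards [hub] with x hx l
    rw [hes, hx.1, map_zero]
  · change ∀ᶠ x in (u : Filter (EuclideanSpace ℝ (Fin M))), _
    filter_upwards [hub, hu0 hF.eventually_analyticAt] with x hx hxa j
    have hxa : AnalyticAt ℝ F x := hxa
    have hex := hx.2.1
    have hl := Classical.choose_spec hex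
    have hwl : ∀ l, w x l = Classical.choose hex (EuclideanSpace.single l 1) := fun l => by
      simp only [w]; rw [dif_pos hex]
    have hfd : ∀ l, fderiv ℝ (fun z => pr l (F (es z))) (e x) (Pi.single j 1) =
        fderiv ℝ F x (EuclideanSpace.single j 1) l := by
      intro l
      have h1 : HasFDerivAt F (fderiv ℝ F x) (es (e x)) := by
        rw [hes]; exact hxa.differentiableAt.hasFDerivAt
      have h2 := (pr l).hasFDerivAt.comp (e x) (h1.comp (e x) es.hasFDerivAt)
      have h3 : fderiv ℝ (fun z => pr l (F (es z))) (e x) = _ := h2.fderiv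
      rw [h3]
      rfl
    have h4 := hl (EuclideanSpace.single j 1)
    have h5 : inner ℝ x (EuclideanSpace.single j (1 : ℝ)) = x j := by
      simp [EuclideanSpace.inner_single_right]
    rw [h5] at h4
    change x j = _
    rw [h4]
    simp only [hfd, hwl]
    generalize fderiv ℝ F x (EuclideanSpace.single j 1) = v
    have h6 : v = ∑ l, v l • EuclideanSpace.single l (1 : ℝ) := by
      ext k
      simp [Pi.single_apply]
    conv_lhs => rw [h6]
    simp [map_sum, mul_comm]


theorem fderiv_milnor {m k : ℕ} {P : EuclideanSpace ℝ (Fin m) → EuclideanSpace ℝ (Fin k)}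
    {x : EuclideanSpace ℝ (Fin m)} (hP : DifferentiableAt ℝ P x) (h : EuclideanSpace ℝ (Fin m)) :
    fderiv ℝ (fun y => (P y, ‖y‖ ^ 2)) x h = (fderiv ℝ P x h, 2 * inner ℝ x h) := by
  have h1 := (hP.hasFDerivAt.prodMk (hasStrictFDerivAt_norm_sq x).hasFDerivAt).fderiv
  rw [h1]
  simp

theorem milnor_of_ex {m k : ℕ} {P : EuclideanSpace ℝ (Fin m) → EuclideanSpace ℝ (Fin k)}
    {x : EuclideanSpace ℝ (Fin m)} (hP : DifferentiableAt ℝ P x)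
    (hl : ∃ l : EuclideanSpace ℝ (Fin k) →ₗ[ℝ] ℝ, ∀ h, inner ℝ x h = l (fderiv ℝ P x h)) :
    x ∈ MilnorSet P := by
  obtain ⟨l, hl⟩ := hl
  intro hs
  obtain ⟨h, hh⟩ := hs (0, 1)
  rw [fderiv_milnor hP, Prod.mk.injEq] at hh
  rw [hl h, hh.1, map_zero] at hh
  simp at hh

theorem ex_of_ker {m k : ℕ} (A : EuclideanSpace ℝ (Fin m) →L[ℝ] EuclideanSpace ℝ (Fin k))
    (hA : Function.Surjective A) (x : EuclideanSpace ℝ (Fin m))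
    (hk : ∀ h, A h = 0 → inner ℝ x h = (0 : ℝ)) :
    ∃ l : EuclideanSpace ℝ (Fin k) →ₗ[ℝ] ℝ, ∀ h, inner ℝ x h = l (A h) := by
  obtain ⟨s, hs⟩ := LinearMap.exists_rightInverse_of_surjective 
    (A : EuclideanSpace ℝ (Fin m) →ₗ[ℝ] EuclideanSpace ℝ (Fin k))
    (LinearMap.range_eq_top.mpr hA)
  have hs' : ∀ v, A (s v) = v := fun v => congrArg (fun l => l v) hs
  refine ⟨(innerSL ℝ x : EuclideanSpace ℝ (Fin m) →ₗ[ℝ] ℝ).comp s, fun h => ?_⟩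
  have := hk (h - s (A h)) (by rw [map_sub, hs', sub_self])
  rw [inner_sub_right, sub_eq_zero] at this
  exact this

theorem ex_of_milnor {m k : ℕ} {P : EuclideanSpace ℝ (Fin m) → EuclideanSpace ℝ (Fin k)}
    {x : EuclideanSpace ℝ (Fin m)} (hP : DifferentiableAt ℝ P x) (hx : x ∈ MilnorSet P)
    (hS : x ∉ Sing P) :
    ∃ l : EuclideanSpace ℝ (Fin k) →ₗ[ℝ] ℝ, ∀ h, inner ℝ x h = l (fderiv ℝ P x h) := by
  have hsurj : Function.Surjective (fderiv ℝ P x) := not_not.mp hS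
  refine ex_of_ker _ hsurj x ?_
  by_contra! hcon
  obtain ⟨h0, hh0, hne⟩ := hcon
  apply hx
  rintro ⟨v, t⟩
  obtain ⟨h1, hh1⟩ := hsurj v
  refine ⟨h1 + ((t / 2 - inner ℝ x h1) / inner ℝ x h0) • h0, ?_⟩
  rw [fderiv_milnor hP, map_add, map_smul, hh0, hh1, inner_add_right, inner_smul_right]
  rw [smul_zero, add_zero, div_mul_cancel₀ _ hne]
  congr 1
  ring

theorem ex_closed {m k : ℕ} {P : EuclideanSpace ℝ (Fin m) → EuclideanSpace ℝ (Fin k)}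
    {x0 : EuclideanSpace ℝ (Fin m)} (hP : AnalyticAt ℝ P x0) (hS : x0 ∉ Sing P)
    (hf : ∃ᶠ x in 𝓝 x0, ∃ l : EuclideanSpace ℝ (Fin k) →ₗ[ℝ] ℝ,
      ∀ h, inner ℝ x h = l (fderiv ℝ P x h)) :
    ∃ l : EuclideanSpace ℝ (Fin k) →ₗ[ℝ] ℝ, ∀ h, inner ℝ x0 h = l (fderiv ℝ P x0 h) := by
  have hsurj : Function.Surjective (fderiv ℝ P x0) := not_not.mp hS
  refine ex_of_ker _ hsurj x0 ?_
  intro h hh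
  obtain ⟨s0, hs⟩ := LinearMap.exists_rightInverse_of_surjective 
    (fderiv ℝ P x0 : EuclideanSpace ℝ (Fin m) →ₗ[ℝ] EuclideanSpace ℝ (Fin k))
    (LinearMap.range_eq_top.mpr hsurj)
  have hs' : ∀ v, fderiv ℝ P x0 (s0 v) = v := fun v => congrArg (fun l => l v) hs
  let s : EuclideanSpace ℝ (Fin k) →L[ℝ] EuclideanSpace ℝ (Fin m) := LinearMap.toContinuousLinearMap s0
  have hone : (fderiv ℝ P x0).comp s = 1 := by
    ext1 v
    exact hs' v
  have hdc : ContinuousAt (fderiv ℝ P) x0 := hP.fderiv.continuousAt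
  let Φ : EuclideanSpace ℝ (Fin m) → EuclideanSpace ℝ (Fin k) →L[ℝ] EuclideanSpace ℝ (Fin k) :=
    fun x => (fderiv ℝ P x).comp s
  have hΦ : ContinuousAt Φ x0 := hdc.clm_comp continuousAt_const
  have hΦ0 : IsUnit (Φ x0) := by simp only [Φ]; rw [hone]; exact isUnit_one
  have hinv : ContinuousAt (fun x => Ring.inverse (Φ x)) x0 := by
    obtain ⟨a, ha⟩ := hΦ0
    refine ContinuousAt.comp (g := Ring.inverse) ?_ hΦ
    rw [← ha]
    exact NormedRing.inverse_continuousAt a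
  let φ : EuclideanSpace ℝ (Fin m) → EuclideanSpace ℝ (Fin m) :=
    fun x => h - s (Ring.inverse (Φ x) (fderiv ℝ P x h))
  have hφ : ContinuousAt φ x0 := by
    refine continuousAt_const.sub (s.continuous.continuousAt.comp ?_)
    exact hinv.clm_apply (hdc.clm_apply continuousAt_const)
  have hφ0 : φ x0 = h := by simp [φ, hh]
  have hker : ∀ᶠ x in 𝓝 x0, fderiv ℝ P x (φ x) = 0 := by
    filter_upwards [hΦ.eventually (Units.isOpen.mem_nhds hΦ0)] with x hx
    have h1 := congrArg (fun l => l (fderiv ℝ P x h)) (Ring.mul_inverse_cancel _ hx)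
    have h2 : fderiv ℝ P x (s (Ring.inverse (Φ x) (fderiv ℝ P x h))) = fderiv ℝ P x h := h1
    simp only [φ]
    rw [map_sub, h2, sub_self]
  have hfr : ∃ᶠ x in 𝓝 x0, inner ℝ x (φ x) = (0 : ℝ) := by
    refine (hf.and_eventually hker).mono ?_
    rintro x ⟨⟨l, hl⟩, hx⟩
    rw [hl, hx, map_zero]
  by_contra hne
  have hc : ContinuousAt (fun x => (inner ℝ x (φ x) : ℝ)) x0 := ContinuousAt.inner (𝕜 := ℝ) continuousAt_id hφ
  have := hc.eventually_ne (y := 0) (by rw [hφ0]; exact hne)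
  exact hfr (this.mono fun x hx => hx)

/-- Assume F is tame with Disc F ⊆ {0} and F(M(H)) ⊆ M(G) as set germs
at the origin. If G is tame, then H = G ∘ F is tame. -/
theorem stmt_14 {M N K : ℕ} (hMN : M ≥ N) (hNK : N ≥ K) (hK2 : K ≥ 2)
    (U : Set (EuclideanSpace ℝ (Fin M))) (V : Set (EuclideanSpace ℝ (Fin N)))
    (hUopen : IsOpen U) (hU0 : (0 : EuclideanSpace ℝ (Fin M)) ∈ U)
    (hVopen : IsOpen V) (hV0 : (0 : EuclideanSpace ℝ (Fin N)) ∈ V)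
    (F : EuclideanSpace ℝ (Fin M) → EuclideanSpace ℝ (Fin N))
    (G : EuclideanSpace ℝ (Fin N) → EuclideanSpace ℝ (Fin K))
    (hF : AnalyticOnNhd ℝ F U) (hG : AnalyticOnNhd ℝ G V)
    (hF0 : F 0 = 0) (hG0 : G 0 = 0) (hFUV : F '' U ⊆ V)
    (hFtame : Tame F) (hDiscF : F '' (Sing F ∩ U) ⊆ {0})
    (H : EuclideanSpace ℝ (Fin M) → EuclideanSpace ℝ (Fin K)) (hH : H = G ∘ F)
    (hincl : ∃ ε > 0, closedBall (0 : EuclideanSpace ℝ (Fin M)) ε ⊆ U ∧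
      F '' (MilnorSet H ∩ closedBall 0 ε) ⊆ MilnorSet G)
    (hGtame : Tame G) :
    Tame H := by
  obtain ⟨ε1, hε1, hball, hMM⟩ := hincl
  obtain ⟨εF, hεF, htF⟩ := hFtame
  obtain ⟨εG, hεG, htG⟩ := hGtame
  have hFc : ContinuousAt F 0 := (hF 0 hU0).continuousAt
  obtain ⟨εc, hεc, hc⟩ := Metric.eventually_nhds_iff_ball.mp
    ((main_lemma F (hF 0 hU0)).and (hFc.eventually (Metric.ball_mem_nhds (F 0) hεG)))
  rw [hF0] at hc
  have hε : 0 < min ε1 (min εF εc) := by positivity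
  refine ⟨min ε1 (min εF εc), hε, ?_⟩
  set ε := min ε1 (min εF εc) with hεdef
  have hb1 : ball (0 : EuclideanSpace ℝ (Fin M)) ε ⊆ closedBall 0 ε1 :=
    (ball_subset_ball (min_le_left _ _)).trans ball_subset_closedBall
  have hbF : ball (0 : EuclideanSpace ℝ (Fin M)) ε ⊆ ball 0 εF :=
    ball_subset_ball ((min_le_right _ _).trans (min_le_left _ _))
  have hbc : ball (0 : EuclideanSpace ℝ (Fin M)) ε ⊆ ball 0 εc :=
    ball_subset_ball ((min_le_right _ _).trans (min_le_right _ _))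
  have hFd : ∀ x ∈ ball (0 : EuclideanSpace ℝ (Fin M)) ε, AnalyticAt ℝ F x := fun x hx =>
    hF x (hball (hb1 hx))
  have hGd : ∀ x ∈ ball (0 : EuclideanSpace ℝ (Fin M)) ε, AnalyticAt ℝ G (F x) := fun x hx =>
    hG (F x) (hFUV ⟨x, hball (hb1 hx), rfl⟩)
  have hHd : ∀ x ∈ ball (0 : EuclideanSpace ℝ (Fin M)) ε,
      HasFDerivAt H ((fderiv ℝ G (F x)).comp (fderiv ℝ F x)) x := by
    intro x hx
    rw [hH]
    exact (hGd x hx).differentiableAt.hasFDerivAt.comp x (hFd x hx).differentiableAt.hasFDerivAt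
  rintro x0 ⟨⟨hcl, hx0S⟩, hx0b⟩
  by_contra hx0ne
  have hx0ne : x0 ≠ 0 := hx0ne
  -- facts on the regular Milnor points
  have hpt : ∀ x ∈ (MilnorSet H \ Sing H) ∩ ball (0 : EuclideanSpace ℝ (Fin M)) ε,
      F x ∈ MilnorSet G \ Sing G ∧
      ∃ l : EuclideanSpace ℝ (Fin N) →ₗ[ℝ] ℝ, ∀ h, inner ℝ x h = l (fderiv ℝ F x h) := by
    rintro x ⟨⟨hxM, hxS⟩, hxb⟩
    have hd := hHd x hxb
    refine ⟨⟨hMM ⟨x, ⟨hxM, hb1 hxb⟩, rfl⟩, ?_⟩, ?_⟩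
    · intro hsing
      apply hsing
      have hs : Function.Surjective (fderiv ℝ H x) := not_not.mp hxS
      rw [hd.fderiv] at hs
      exact Function.Surjective.of_comp hs
    · obtain ⟨l, hl⟩ := ex_of_milnor hd.differentiableAt hxM hxS
      refine ⟨l.comp (fderiv ℝ G (F x) :
        EuclideanSpace ℝ (Fin N) →ₗ[ℝ] EuclideanSpace ℝ (Fin K)), fun h => ?_⟩
      rw [hl h, hd.fderiv]
      rfl
  have hfr : ∃ᶠ x in 𝓝 x0, x ∈ (MilnorSet H \ Sing H) ∩ ball (0 : EuclideanSpace ℝ (Fin M)) ε :=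
    mem_closure_iff_frequently.mp hcl
  by_cases hx0F : x0 ∈ Sing F
  · apply hx0ne
    refine htF ⟨⟨?_, hx0F⟩, hbF hx0b⟩
    rw [mem_closure_iff_frequently]
    refine (hfr.and_eventually (isOpen_ne.mem_nhds hx0ne)).mono ?_
    rintro x ⟨hxS, hxne⟩
    obtain ⟨-, hex⟩ := hpt x hxS
    refine ⟨⟨milnor_of_ex (hFd x hxS.2).differentiableAt hex, ?_⟩, hbF hxS.2⟩
    intro hsing
    have hF00 : F x = 0 := hDiscF ⟨x, ⟨hsing, hball (hb1 hxS.2)⟩, rfl⟩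
    exact hxne ((hc x (hbc hxS.2)).1 hF00 hex)
  · have hex := ex_closed (hFd x0 hx0b) hx0F (hfr.mono fun x hx => (hpt x hx).2)
    have hFx0 : F x0 = 0 := by
      refine htG ⟨⟨?_, ?_⟩, (hc x0 (hbc hx0b)).2⟩
      · rw [mem_closure_iff_frequently]
        refine (hFd x0 hx0b).continuousAt.tendsto.frequently (hfr.mono ?_)
        intro x hx
        exact ⟨(hpt x hx).1, (hc x (hbc hx.2)).2⟩
      · intro hs
        apply hx0S
        rw [(hHd x0 hx0b).fderiv]
        exact hs.comp (not_not.mp hx0F)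
    exact hx0ne ((hc x0 (hbc hx0b)).1 hFx0 hex)
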